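/- arXiv:1608.04588 — 4 statements merged into one kernel-verified Lean document; each statement's English description precedes it below -/
import Mathlib

section
/- Let R be a Gorenstein local ring of Krull dimension d, let M and N be finitely generated R-modules, and let n be an integer. Then: (i) if Êxt^i_R(M,N) = 0 for all i ≥ n, then Êxt^i_R(N,M) = 0 for all i < −n; (ii) if Êxt^i_R(M,N) = 0 for all i < n, then Êxt^i_R(N,M) = 0 for all i ≥ d − n. -/
open CategoryTheory CategoryTheory.Limits CategoryTheory.MonoidalCategory Opposite

noncomputable section

universe u

variable (R : Type u) [CommRing R]

/-- Ordinary `Ext` of `R`-modules, via the derived functor `Ext` of Mathlib. -/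
abbrev ExtMod (n : ℕ) (M N : ModuleCat.{u} R) : ModuleCat.{u} R :=
  ((Ext R (ModuleCat.{u} R) n).obj (op M)).obj N

/-- Ordinary `Tor` of `R`-modules, via the derived functor `Tor` of Mathlib. -/
abbrev TorMod (n : ℕ) (M N : ModuleCat.{u} R) : ModuleCat.{u} R :=
  ((Tor (ModuleCat.{u} R) n).obj M).obj N

/-- A finitely generated module `M` is totally reflexive (of G-dimension zero) if the
biduality map is an isomorphism and `Ext^i(M,R) = 0 = Ext^i(M^*,R)` for all `i > 0`. -/
def IsTotallyReflexive (M : ModuleCat.{u} R) : Prop :=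
  Module.Finite R M ∧
  Function.Bijective (Module.Dual.eval R M) ∧
  (∀ i : ℕ, 0 < i → IsZero (ExtMod R i M (ModuleCat.of R R))) ∧
  (∀ i : ℕ, 0 < i → IsZero (ExtMod R i (ModuleCat.of R (Module.Dual R M)) (ModuleCat.of R R)))

/-- `M` admits a resolution `0 → G_n → ⋯ → G_0 → M → 0` by totally reflexive modules. -/
def GDimLE (M : ModuleCat.{u} R) (n : ℕ) : Prop :=
  ∃ (G : ChainComplex (ModuleCat.{u} R) ℕ) (ε : G.X 0 ⟶ M),
    (∀ i, i ≤ n → IsTotallyReflexive R (G.X i)) ∧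
    (∀ i, n < i → IsZero (G.X i)) ∧
    Epi ε ∧
    (∃ w : G.d 1 0 ≫ ε = 0, (ShortComplex.mk (G.d 1 0) ε w).Exact) ∧
    (∀ i, 0 < i → G.ExactAt i)

/-- `M` has finite Gorenstein dimension. -/
def HasFiniteGDim (M : ModuleCat.{u} R) : Prop := ∃ n, GDimLE R M n

/-- The Gorenstein dimension of `M`, as an element of `ℕ∞`. -/
def gdim (M : ModuleCat.{u} R) : ℕ∞ :=
  sInf {c : ℕ∞ | ∃ n : ℕ, c = n ∧ GDimLE R M n}

/-- `M` admits a projective resolution of length at most `n`. -/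
def PdLE (M : ModuleCat.{u} R) (n : ℕ) : Prop :=
  ∃ (G : ChainComplex (ModuleCat.{u} R) ℕ) (ε : G.X 0 ⟶ M),
    (∀ i, Projective (G.X i)) ∧
    (∀ i, n < i → IsZero (G.X i)) ∧
    Epi ε ∧
    (∃ w : G.d 1 0 ≫ ε = 0, (ShortComplex.mk (G.d 1 0) ε w).Exact) ∧
    (∀ i, 0 < i → G.ExactAt i)

/-- `M` has finite projective dimension. -/
def HasFinitePd (M : ModuleCat.{u} R) : Prop := ∃ n, PdLE R M n

/-- The projective dimension of `M`, as an element of `ℕ∞`. -/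
def pdim (M : ModuleCat.{u} R) : ℕ∞ :=
  sInf {c : ℕ∞ | ∃ n : ℕ, c = n ∧ PdLE R M n}

/-- `M` admits an injective resolution `0 → M → I^0 → ⋯ → I^n → 0`. -/
def InjDimLE (M : ModuleCat.{u} R) (n : ℕ) : Prop :=
  ∃ (I : CochainComplex (ModuleCat.{u} R) ℕ) (ι : M ⟶ I.X 0),
    (∀ i, Injective (I.X i)) ∧
    (∀ i, n < i → IsZero (I.X i)) ∧
    Mono ι ∧
    (∃ w : ι ≫ I.d 0 1 = 0, (ShortComplex.mk ι (I.d 0 1) w).Exact) ∧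
    (∀ i, 0 < i → I.ExactAt i)

/-- `M` has finite injective dimension. -/
def HasFiniteInjDim (M : ModuleCat.{u} R) : Prop := ∃ n, InjDimLE R M n

/-- A Gorenstein local ring: a commutative Noetherian local ring of finite self-injective
dimension. -/
def IsGorensteinLocalRing : Prop :=
  IsLocalRing R ∧ IsNoetherianRing R ∧ HasFiniteInjDim R (ModuleCat.of R R)

/-- The grade of a module: `grade M = inf { i | Ext^i(M,R) ≠ 0 }`. -/
def gradeM (M : ModuleCat.{u} R) : ℕ∞ :=
  sInf {c : ℕ∞ | ∃ i : ℕ, c = i ∧ ¬ IsZero (ExtMod R i M (ModuleCat.of R R))}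

/-- A module is G-perfect if its grade equals its Gorenstein dimension. -/
def IsGPerfect (M : ModuleCat.{u} R) : Prop := gradeM R M = gdim R M

/-- An ideal `c` is perfect if `grade (R/c) = pd (R/c)`. -/
def IsPerfectIdeal (c : Ideal R) : Prop :=
  gradeM R (ModuleCat.of R (R ⧸ c)) = pdim R (ModuleCat.of R (R ⧸ c))

/-- A complete resolution `T → P → M` of `M`: `P → M` is a resolution by finite projective
modules, `T` is a totally acyclic complex of finite projective modules, and `θ i` is an
isomorphism for all `i ≫ 0`. -/
structure CompleteResolution (M : ModuleCat.{u} R) where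
  T : ChainComplex (ModuleCat.{u} R) ℤ
  P : ChainComplex (ModuleCat.{u} R) ℤ
  θ : T ⟶ P
  π : P.X 0 ⟶ M
  projT : ∀ i, Projective (T.X i)
  fgT : ∀ i, Module.Finite R (T.X i)
  projP : ∀ i, Projective (P.X i)
  fgP : ∀ i, Module.Finite R (P.X i)
  zeroP : ∀ i : ℤ, i < 0 → IsZero (P.X i)
  epiπ : Epi π
  wπ : P.d 1 0 ≫ π = 0
  exact0 : (ShortComplex.mk (P.d 1 0) π wπ).Exact
  exactP : ∀ i : ℤ, 0 < i → P.ExactAt i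
  exactT : ∀ i : ℤ, T.ExactAt i
  exactTdual : ∀ i : ℤ, (T.linearYonedaObj R (ModuleCat.of R R)).ExactAt i
  iso_eventually : ∃ n₀ : ℤ, ∀ i : ℤ, n₀ ≤ i → IsIso (θ.f i)

/-- Tate cohomology `Êxt^i(M,N) = H^i(Hom(T,N))` computed from a complete resolution of `M`. -/
def TateExt {M : ModuleCat.{u} R} (C : CompleteResolution R M) (N : ModuleCat.{u} R)
    (i : ℤ) : ModuleCat.{u} R :=
  (C.T.linearYonedaObj R N).homology i

/-- Tate homology `T̂or_i(M,N) = H_i(T ⊗ N)` computed from a complete resolution of `M`. -/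
def TateTor {M : ModuleCat.{u} R} (C : CompleteResolution R M) (N : ModuleCat.{u} R)
    (i : ℤ) : ModuleCat.{u} R :=
  ((((tensoringRight (ModuleCat.{u} R)).obj N).mapHomologicalComplex _).obj C.T).homology i

/-- The depth of a module over a local ring: the supremum of the lengths of the
`M`-regular sequences contained in the maximal ideal. -/
def moduleDepth [IsLocalRing R] (M : Type u) [AddCommGroup M] [Module R M] : ℕ∞ :=
  sSup {c : ℕ∞ | ∃ rs : List R, c = rs.length ∧
    (∀ r ∈ rs, r ∈ IsLocalRing.maximalIdeal R) ∧ RingTheory.Sequence.IsRegular M rs}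

/-- `E` is an injective envelope of the residue field `k`: an injective module which is an
essential extension of `k`. -/
def IsInjectiveEnvelopeOfResidueField [IsLocalRing R] (E : Type u) [AddCommGroup E]
    [Module R E] : Prop :=
  Injective (ModuleCat.of R E) ∧
  ∃ ι : IsLocalRing.ResidueField R →ₗ[R] E,
    Function.Injective ι ∧
    ∀ N : Submodule R E, N ≠ ⊥ → N ⊓ LinearMap.range ι ≠ ⊥


/-- A minimal free resolution `⋯ → F_1 → F_0 → M → 0` of a finitely generated module over a
local ring, recorded by its Betti numbers `b n` and differentials with image inside
`m • F_n`. -/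
structure MinFreeRes [IsLocalRing R] (M : Type u) [AddCommGroup M] [Module R M] where
  b : ℕ → ℕ
  d : ∀ n : ℕ, ((Fin (b (n+1)) → R) →ₗ[R] (Fin (b n) → R))
  aug : (Fin (b 0) → R) →ₗ[R] M
  aug_surj : Function.Surjective aug
  exact_zero : LinearMap.ker aug = LinearMap.range (d 0)
  exact_succ : ∀ n, LinearMap.ker (d n) = LinearMap.range (d (n+1))
  minimal : ∀ n, LinearMap.range (d n) ≤ (IsLocalRing.maximalIdeal R) • ⊤

/-- The Betti numbers of `M` are eventually bounded by `γ · n^(c-1)`. -/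
def CxLE [IsLocalRing R] (M : Type u) [AddCommGroup M] [Module R M] (c : ℕ) : Prop :=
  ∃ (F : MinFreeRes R M) (γ : ℝ) (n₀ : ℕ),
    ∀ n : ℕ, n₀ ≤ n → (F.b n : ℝ) ≤ γ * (n : ℝ) ^ ((c : ℤ) - 1)

/-- The complexity of a module: the least `c` such that the Betti numbers are eventually
bounded by `γ · n^(c-1)` for some `γ`. -/
def complexity [IsLocalRing R] (M : Type u) [AddCommGroup M] [Module R M] : ℕ∞ :=
  sInf {e : ℕ∞ | ∃ c : ℕ, e = c ∧ CxLE R M c}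

/-- The pushout `K_η` of a map `f : Ω^{j+1} M → M` (representing a degree-`(j+1)`
homogeneous element `η` of `Ext^*(M,M)`) along the inclusion `Ω^{j+1} M ↪ F_j`: the
cokernel of `(f, -incl) : Ω^{j+1} M → M ⊕ F_j`. -/
abbrev PushoutMod [IsLocalRing R] {M : Type u} [AddCommGroup M] [Module R M]
    (F : MinFreeRes R M) (j : ℕ) (f : LinearMap.range (F.d j) →ₗ[R] M) : Type u :=
  (M × (Fin (F.b j) → R)) ⧸
    LinearMap.range (LinearMap.prod f (-(LinearMap.range (F.d j)).subtype))

/-- Auxiliary predicate: `M` has reducible complexity, with recursion depth `≤ c`. -/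
def RedCxAux [IsLocalRing R] :
    ℕ → ∀ (M : Type u) (_ : AddCommGroup M) (_ : Module R M), Prop
  | 0, M, g, m =>
      letI := g; letI := m
      HasFinitePd R (ModuleCat.of R M)
  | (c+1), M, g, m =>
      letI := g; letI := m
      HasFinitePd R (ModuleCat.of R M) ∨
      (complexity R M < ⊤ ∧ 0 < complexity R M ∧
        ∃ (j : ℕ) (F : MinFreeRes R M) (f : LinearMap.range (F.d j) →ₗ[R] M),
          complexity R (PushoutMod R F j f) < complexity R M ∧
          moduleDepth R (PushoutMod R F j f) = moduleDepth R M ∧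
          RedCxAux c (PushoutMod R F j f) inferInstance inferInstance)

/-- `M` has reducible complexity. -/
def HasReducibleComplexity [IsLocalRing R] (M : Type u) [AddCommGroup M] [Module R M] :
    Prop :=
  ∃ c : ℕ, RedCxAux R c M inferInstance inferInstance

/-- `L` is (isomorphic to) `λ N = Ω Tr N`, computed from a minimal free presentation of `N`
over the local ring `S`. -/
def IsLambdaOf (S : Type u) [CommRing S] [IsLocalRing S]
    (N L : Type u) [AddCommGroup N] [Module S N] [AddCommGroup L] [Module S L] : Prop :=
  ∃ (n₀ n₁ : ℕ) (g : (Fin n₀ → S) →ₗ[S] N) (f : (Fin n₁ → S) →ₗ[S] (Fin n₀ → S)),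
    Function.Surjective g ∧
    LinearMap.range f = LinearMap.ker g ∧
    LinearMap.ker g ≤ (IsLocalRing.maximalIdeal S) • ⊤ ∧
    LinearMap.ker f ≤ (IsLocalRing.maximalIdeal S) • ⊤ ∧
    Nonempty (L ≃ₗ[S] LinearMap.range f.dualMap)

/-- `M` and `N` are linked by the ideal `c`: both are annihilated by `c` (hence are
`R/c`-modules) and `M ≅ λ_{R/c} N`, `N ≅ λ_{R/c} M`. -/
def LinkedBy (c : Ideal R) (M N : Type u) [AddCommGroup M] [Module (R ⧸ c) M]
    [AddCommGroup N] [Module (R ⧸ c) N] [IsLocalRing (R ⧸ c)] : Prop :=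
  IsLambdaOf (R ⧸ c) N M ∧ IsLambdaOf (R ⧸ c) M N

namespace TateSym

section ExtVanishing

/-- `Ext^k(H, R) = 0`. -/
def EV (k : ℕ) (H : Type u) [AddCommGroup H] [Module R H] : Prop :=
  Subsingleton (Abelian.Ext (ModuleCat.of R H) (ModuleCat.of R R) k)

variable {R}
variable {A B C : Type u} [AddCommGroup A] [Module R A] [AddCommGroup B] [Module R B]
  [AddCommGroup C] [Module R C]

/-- The short exact sequence of modules attached to elementwise data. -/
abbrev sc (f : A →ₗ[R] B) (g : B →ₗ[R] C) (h : Function.Exact f g) :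
    ShortComplex (ModuleCat.{u} R) :=
  ModuleCat.shortComplexOfCompEqZero f g h.linearMap_comp_eq_zero

lemma sc_exact (f : A →ₗ[R] B) (g : B →ₗ[R] C) (h : Function.Exact f g)
    (hf : Function.Injective f) (hg : Function.Surjective g) : (sc f g h).ShortExact :=
  ModuleCat.shortComplex_shortExact _ h hf hg

lemma EV.mid {f : A →ₗ[R] B} {g : B →ₗ[R] C} (h : Function.Exact f g)
    (hf : Function.Injective f) (hg : Function.Surjective g) {k : ℕ}
    (hA : EV R k A) (hC : EV R k C) : EV R k B := by
  unfold EV at *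
  refine ⟨fun a b => ?_⟩
  have key : ∀ x : Abelian.Ext (ModuleCat.of R B) (ModuleCat.of R R) k, x = 0 := by
    intro x
    obtain ⟨y, rfl⟩ := Abelian.Ext.contravariant_sequence_exact₂ (sc_exact f g h hf hg) _ x
      (Subsingleton.elim (α := Abelian.Ext (ModuleCat.of R A) (ModuleCat.of R R) k) _ _)
    rw [show y = 0 from
      Subsingleton.elim (α := Abelian.Ext (ModuleCat.of R C) (ModuleCat.of R R) k) _ _]
    simp
  rw [key a, key b]

lemma EV.right {f : A →ₗ[R] B} {g : B →ₗ[R] C} (h : Function.Exact f g)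
    (hf : Function.Injective f) (hg : Function.Surjective g) {k : ℕ}
    (hA : EV R k A) (hB : EV R (k + 1) B) : EV R (k + 1) C := by
  unfold EV at *
  refine ⟨fun a b => ?_⟩
  have key : ∀ x : Abelian.Ext (ModuleCat.of R C) (ModuleCat.of R R) (k + 1), x = 0 := by
    intro x
    obtain ⟨y, rfl⟩ := Abelian.Ext.contravariant_sequence_exact₃ (sc_exact f g h hf hg) _ x
      (Subsingleton.elim (α := Abelian.Ext (ModuleCat.of R B) (ModuleCat.of R R) (k + 1)) _ _)
      (add_comm 1 k)
    rw [show y = 0 from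
      Subsingleton.elim (α := Abelian.Ext (ModuleCat.of R A) (ModuleCat.of R R) k) _ _]
    simp
  rw [key a, key b]

lemma EV.left {f : A →ₗ[R] B} {g : B →ₗ[R] C} (h : Function.Exact f g)
    (hf : Function.Injective f) (hg : Function.Surjective g) {k : ℕ}
    (hB : EV R k B) (hC : EV R (k + 1) C) : EV R k A := by
  unfold EV at *
  refine ⟨fun a b => ?_⟩
  have key : ∀ x : Abelian.Ext (ModuleCat.of R A) (ModuleCat.of R R) k, x = 0 := by
    intro x
    obtain ⟨y, rfl⟩ := Abelian.Ext.contravariant_sequence_exact₁ (sc_exact f g h hf hg) _ x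
      (add_comm 1 k)
      (Subsingleton.elim (α := Abelian.Ext (ModuleCat.of R C) (ModuleCat.of R R) (k + 1)) _ _)
    rw [show y = 0 from
      Subsingleton.elim (α := Abelian.Ext (ModuleCat.of R B) (ModuleCat.of R R) k) _ _]
    simp
  rw [key a, key b]

lemma EV.of_subsingleton (k : ℕ) (H : Type u) [AddCommGroup H] [Module R H] [Subsingleton H] :
    EV R k H := by
  unfold EV
  refine ⟨fun a b => ?_⟩
  have key : ∀ x : Abelian.Ext (ModuleCat.of R H) (ModuleCat.of R R) k, x = 0 := by
    intro x
    rw [← Abelian.Ext.mk₀_id_comp x]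
    have : 𝟙 (ModuleCat.of R H) = 0 :=
      (ModuleCat.isZero_of_subsingleton (ModuleCat.of R H)).eq_of_src _ _
    rw [this]; simp
  rw [key a, key b]

lemma EV.congr {k : ℕ} (e : A ≃ₗ[R] B) (hA : EV R k A) : EV R k B :=
  EV.mid (f := e.toLinearMap) (g := (0 : B →ₗ[R] PUnit.{u+1}))
    ((e.exact_zero_iff_surjective _).2 e.surjective) e.injective
    (Function.surjective_to_subsingleton _) hA (EV.of_subsingleton _ _)

lemma EV.of_projective (k : ℕ) (H : Type u) [AddCommGroup H] [Module R H]
    [Module.Projective R H] : EV R (k + 1) H := by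
  unfold EV
  have : Projective (ModuleCat.of R H) := (IsProjective.iff_projective H).1 inferInstance
  exact ⟨fun a b => (Abelian.Ext.eq_zero_of_projective a).trans
    (Abelian.Ext.eq_zero_of_projective b).symm⟩

lemma EV.extend {f : A →ₗ[R] B} {g : B →ₗ[R] C} (h : Function.Exact f g)
    (hf : Function.Injective f) (hg : Function.Surjective g) (hC : EV R 1 C)
    (φ : A →ₗ[R] R) : ∃ ψ : B →ₗ[R] R, ψ ∘ₗ f = φ := by
  unfold EV at *
  obtain ⟨y, hy⟩ := Abelian.Ext.contravariant_sequence_exact₁ (sc_exact f g h hf hg)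
    (ModuleCat.of R R) (Abelian.Ext.mk₀ (ModuleCat.ofHom φ)) (add_comm 1 0)
      (Subsingleton.elim (α := Abelian.Ext (ModuleCat.of R C) (ModuleCat.of R R) 1) _ _)
  obtain ⟨y, rfl⟩ := (Abelian.Ext.mk₀_bijective _ _).2 y
  rw [Abelian.Ext.mk₀_comp_mk₀] at hy
  have := (Abelian.Ext.mk₀_bijective _ _).1 hy
  refine ⟨y.hom, ?_⟩
  have h2 := congrArg ModuleCat.Hom.hom this
  exact h2

lemma EV.of_extend {f : A →ₗ[R] B} {g : B →ₗ[R] C} (h : Function.Exact f g)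
    (hf : Function.Injective f) (hg : Function.Surjective g) (hB : EV R 1 B)
    (H : ∀ φ : A →ₗ[R] R, ∃ ψ : B →ₗ[R] R, ψ ∘ₗ f = φ) : EV R 1 C := by
  unfold EV at *
  refine ⟨fun a b => ?_⟩
  have key : ∀ x : Abelian.Ext (ModuleCat.of R C) (ModuleCat.of R R) 1, x = 0 := by
    intro x
    obtain ⟨y, rfl⟩ := Abelian.Ext.contravariant_sequence_exact₃ (sc_exact f g h hf hg) _ x
      (Subsingleton.elim (α := Abelian.Ext (ModuleCat.of R B) (ModuleCat.of R R) 1) _ _)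
      (add_comm 1 0)
    obtain ⟨y, rfl⟩ := (Abelian.Ext.mk₀_bijective _ _).2 y
    obtain ⟨ψ, hψ⟩ := H y.hom
    have : y = (sc f g h).f ≫ ModuleCat.ofHom ψ := by
      apply ModuleCat.hom_ext
      exact hψ.symm
    rw [this, ← Abelian.Ext.mk₀_comp_mk₀]
    exact (sc_exact f g h hf hg).extClass_comp_assoc _
  rw [key a, key b]

lemma EV.nakayama [IsLocalRing R] [IsNoetherianRing R] [Module.Finite R A]
    (x : R) (hx : x ∈ IsLocalRing.maximalIdeal R)
    {g : A →ₗ[R] C} (h : Function.Exact (LinearMap.lsmul R A x) g)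
    (hf : Function.Injective (LinearMap.lsmul R A x)) (hg : Function.Surjective g)
    {k : ℕ} (hC : EV R (k + 1) C) : EV R k A := by
  unfold EV at *
  rw [← Submodule.subsingleton_iff R]
  have key : ∀ y : Abelian.Ext (ModuleCat.of R A) (ModuleCat.of R R) k, ∃ z, y = x • z := by
    intro y
    obtain ⟨z, hz⟩ := Abelian.Ext.contravariant_sequence_exact₁ (sc_exact _ g h hf hg) _ y
      (add_comm 1 k)
      (Subsingleton.elim (α := Abelian.Ext (ModuleCat.of R C) (ModuleCat.of R R) (k + 1)) _ _)
    refine ⟨z, ?_⟩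
    have : (sc _ g h).f = x • 𝟙 (ModuleCat.of R A) := rfl
    rw [← hz, this, Abelian.Ext.mk₀_smul, Abelian.Ext.smul_comp]
    exact congrArg _ (Abelian.Ext.mk₀_id_comp z)
  refine subsingleton_of_bot_eq_top ?_
  symm
  refine Submodule.eq_bot_of_le_smul_of_le_jacobson_bot (IsLocalRing.maximalIdeal R) ⊤
    (Module.Finite.fg_top) ?_ (IsLocalRing.maximalIdeal_le_jacobson ⊥)
  intro y _
  obtain ⟨z, rfl⟩ := key y
  exact Submodule.smul_mem_smul hx trivial

end ExtVanishing

end TateSym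

namespace TateSym

section Bass

variable {R}

lemma exact_lsmul_factor (I : Ideal R) (x : R) :
    Function.Exact (LinearMap.lsmul R (R ⧸ I) x)
      (Submodule.factor (le_sup_left : I ≤ I ⊔ Ideal.span {x})) := by
  intro y
  obtain ⟨r, rfl⟩ := Submodule.Quotient.mk_surjective I y
  constructor
  · intro h
    have h1 : r ∈ I ⊔ Ideal.span {x} := by
      rw [← Submodule.Quotient.mk_eq_zero]
      exact h
    obtain ⟨a, ha, b, hb, rfl⟩ := Submodule.mem_sup.1 h1
    obtain ⟨c, rfl⟩ := Ideal.mem_span_singleton'.1 hb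
    refine ⟨Submodule.Quotient.mk c, ?_⟩
    simp only [LinearMap.lsmul_apply, ← Submodule.Quotient.mk_smul, smul_eq_mul]
    rw [Submodule.Quotient.eq]
    have : x * c - (a + c * x) = - a := by ring
    rw [this]; exact I.neg_mem ha
  · rintro ⟨z, hz⟩
    obtain ⟨s, rfl⟩ := Submodule.Quotient.mk_surjective I z
    rw [← hz]
    simp only [LinearMap.lsmul_apply, map_smul]
    change x • (Submodule.Quotient.mk s : R ⧸ (I ⊔ Ideal.span {x})) = 0
    rw [← Submodule.Quotient.mk_smul, Submodule.Quotient.mk_eq_zero, smul_eq_mul]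
    exact Ideal.mul_mem_right _ _ (Ideal.mem_sup_right (Ideal.mem_span_singleton_self x))

lemma exists_reg_or_embed [IsLocalRing R] [IsNoetherianRing R] (I : Ideal R) :
    (∃ f : (R ⧸ IsLocalRing.maximalIdeal R) →ₗ[R] (R ⧸ I), Function.Injective f) ∨
    (∃ x ∈ IsLocalRing.maximalIdeal R, Function.Injective (LinearMap.lsmul R (R ⧸ I) x)) := by
  by_cases h : IsLocalRing.maximalIdeal R ∈ associatedPrimes R (R ⧸ I)
  · left
    exact ((isAssociatedPrime_iff_exists_injective_linearMap _ _).1 h).2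
  · right
    by_contra hcon
    push Not at hcon
    apply h
    have hsub : (IsLocalRing.maximalIdeal R : Set R) ⊆
        ⋃ p ∈ associatedPrimes R (R ⧸ I), (p : Set R) := by
      rw [biUnion_associatedPrimes_eq_zero_divisors]
      intro x hx
      have := hcon x hx
      rw [injective_iff_map_eq_zero] at this
      push Not at this
      obtain ⟨y, hy, hy0⟩ := this
      exact ⟨y, hy0, hy⟩
    have hfin := associatedPrimes.finite R (R ⧸ I)
    have := (Ideal.subset_union_prime_finite (R := R) hfin (f := id) ⊥ ⊥
      (fun p hp _ _ => IsAssociatedPrime.isPrime hp)).1 hsub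
    obtain ⟨p, hp, hle⟩ := this
    have hpp : p.IsPrime := IsAssociatedPrime.isPrime hp
    have : IsLocalRing.maximalIdeal R = p :=
      le_antisymm hle (IsLocalRing.le_maximalIdeal hpp.ne_top)
    rw [this]; exact hp

lemma chain [IsLocalRing R] [IsNoetherianRing R] (n : ℕ) : ∀ (I : Ideal R), I ≠ ⊤ → ∀ t : ℕ,
    ringKrullDim (R ⧸ I) ≤ n → (∀ m, t < m → EV R m (R ⧸ I)) →
    ∃ J : Ideal R, (∀ m, t + n < m → EV R m (R ⧸ J)) ∧
      ∃ f : (R ⧸ IsLocalRing.maximalIdeal R) →ₗ[R] (R ⧸ J), Function.Injective f := by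
  induction n with
  | zero =>
    intro I hI t hd hE
    rcases exists_reg_or_embed I with h | ⟨x, hx, hinj⟩
    · exact ⟨I, fun m hm => hE m (by omega), h⟩
    · exfalso
      have hI' : I ⊔ Ideal.span {x} ≠ ⊤ := by
        refine ne_top_of_le_ne_top (Ideal.IsPrime.ne_top' (I := IsLocalRing.maximalIdeal R)) ?_
        exact sup_le (IsLocalRing.le_maximalIdeal hI)
          ((Ideal.span_singleton_le_iff_mem _).2 hx)
      have hdim : ringKrullDim (R ⧸ (I ⊔ Ideal.span {x})) + 1 ≤ ringKrullDim (R ⧸ I) := by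
        refine ringKrullDim_succ_le_of_surjective
          (Ideal.Quotient.factor (le_sup_left : I ≤ I ⊔ Ideal.span {x}))
          (Ideal.Quotient.factor_surjective _) (r := Ideal.Quotient.mk I x) ?_ ?_
        · rw [mem_nonZeroDivisors_iff_right]
          intro z hz
          apply hinj
          simp only [LinearMap.lsmul_apply, smul_zero]
          rw [Algebra.smul_def, mul_comm]; exact hz
        · rw [Ideal.Quotient.factor_mk, Ideal.Quotient.eq_zero_iff_mem]
          exact Ideal.mem_sup_right (Ideal.mem_span_singleton_self x)
      have : Nontrivial (R ⧸ (I ⊔ Ideal.span {x})) := Ideal.Quotient.nontrivial_iff.2 hI'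
      have h0 : 0 ≤ ringKrullDim (R ⧸ (I ⊔ Ideal.span {x})) := ringKrullDim_nonneg_of_nontrivial
      have h1 : (1 : WithBot ℕ∞) ≤ 0 := by
        calc (1 : WithBot ℕ∞) = 0 + 1 := by simp
          _ ≤ _ := by gcongr
          _ ≤ _ := hdim
          _ ≤ 0 := by simpa using hd
      exact absurd h1 (by decide)
  | succ n ih =>
    intro I hI t hd hE
    rcases exists_reg_or_embed I with h | ⟨x, hx, hinj⟩
    · exact ⟨I, fun m hm => hE m (by omega), h⟩
    · have hI' : I ⊔ Ideal.span {x} ≠ ⊤ := by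
        refine ne_top_of_le_ne_top (Ideal.IsPrime.ne_top' (I := IsLocalRing.maximalIdeal R)) ?_
        exact sup_le (IsLocalRing.le_maximalIdeal hI)
          ((Ideal.span_singleton_le_iff_mem _).2 hx)
      have hdim : ringKrullDim (R ⧸ (I ⊔ Ideal.span {x})) + 1 ≤ ringKrullDim (R ⧸ I) := by
        refine ringKrullDim_succ_le_of_surjective
          (Ideal.Quotient.factor (le_sup_left : I ≤ I ⊔ Ideal.span {x}))
          (Ideal.Quotient.factor_surjective _) (r := Ideal.Quotient.mk I x) ?_ ?_
        · rw [mem_nonZeroDivisors_iff_right]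
          intro z hz
          apply hinj
          simp only [LinearMap.lsmul_apply, smul_zero]
          rw [Algebra.smul_def, mul_comm]; exact hz
        · rw [Ideal.Quotient.factor_mk, Ideal.Quotient.eq_zero_iff_mem]
          exact Ideal.mem_sup_right (Ideal.mem_span_singleton_self x)
      have hdim' : ringKrullDim (R ⧸ (I ⊔ Ideal.span {x})) ≤ n := by
        have h2 := hdim.trans hd
        have : Nontrivial (R ⧸ (I ⊔ Ideal.span {x})) := Ideal.Quotient.nontrivial_iff.2 hI'
        push_cast at h2
        exact ENat.WithBot.add_le_add_one_right_iff.1 h2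
      obtain ⟨J, hJ, hf⟩ := ih (I ⊔ Ideal.span {x}) hI' (t + 1) hdim' (by
        intro m hm
        obtain ⟨m, rfl⟩ : ∃ m', m = m' + 1 := ⟨m - 1, by omega⟩
        exact EV.right (exact_lsmul_factor I x) hinj (Submodule.factor_surjective _)
          (hE m (by omega)) (hE (m + 1) (by omega)))
      exact ⟨J, fun m hm => hJ m (by omega), hf⟩

lemma bass_step [IsLocalRing R] [IsNoetherianRing R] (d : ℕ) (hd : ringKrullDim R = d)
    (k : ℕ) (hk : d < k)
    (h : ∀ (H : Type u) [AddCommGroup H] [Module R H] [Module.Finite R H], EV R (k + 1) H)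
    (H : Type u) [AddCommGroup H] [Module R H] (hH : Module.Finite R H) : EV R k H := by
  have hres : EV R k (R ⧸ IsLocalRing.maximalIdeal R) := by
    obtain ⟨J, hJ, f, hf⟩ := chain (R := R) d ⊥ (bot_ne_top) 0
      (by rw [← hd]; exact ringKrullDim_quotient_le _)
      (fun m hm => by
        obtain ⟨m, rfl⟩ : ∃ m', m = m' + 1 := ⟨m - 1, by omega⟩
        exact EV.congr (Submodule.quotEquivOfEqBot ⊥ rfl).symm (EV.of_projective m R))
    exact EV.left (f.exact_map_mkQ_range) hf (Submodule.mkQ_surjective _) (hJ k (by omega)) (h _)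
  induction hH using IsNoetherianRing.induction_on_isQuotientEquivQuotientPrime R with
  | subsingleton N => exact EV.of_subsingleton _ _
  | quotient N p e =>
    refine EV.congr e.symm ?_
    by_cases hp : p.1 = IsLocalRing.maximalIdeal R
    · rw [hp]; exact hres
    · have hpp := p.2
      have hlt : p.1 < IsLocalRing.maximalIdeal R :=
        lt_of_le_of_ne (IsLocalRing.le_maximalIdeal hpp.ne_top) hp
      obtain ⟨x, hx, hxp⟩ := SetLike.exists_of_lt hlt
      refine EV.nakayama x hx (exact_lsmul_factor p.1 x) ?_ (Submodule.factor_surjective _) (h _)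
      rw [injective_iff_map_eq_zero]
      intro y hy
      obtain ⟨r, rfl⟩ := Submodule.Quotient.mk_surjective _ y
      rw [LinearMap.lsmul_apply, ← Submodule.Quotient.mk_smul, Submodule.Quotient.mk_eq_zero] at hy
      rw [Submodule.Quotient.mk_eq_zero]
      exact (hpp.mem_or_mem hy).resolve_left hxp
  | exact N₁ N₂ N₃ f g hf hg hfg h1 h3 => exact EV.mid hfg hf hg h1 h3

lemma bass [IsLocalRing R] [IsNoetherianRing R] (d : ℕ) (hd : ringKrullDim R = d)
    (r : ℕ) (hr : ∀ k, r < k → ∀ (H : Type u) [AddCommGroup H] [Module R H]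
      [Module.Finite R H], EV R k H)
    (k : ℕ) (hk : d < k) (H : Type u) [AddCommGroup H] [Module R H] [Module.Finite R H] :
    EV R k H := by
  have key : ∀ j k, d < k → r < k + j → ∀ (H : Type u) [AddCommGroup H] [Module R H]
      [Module.Finite R H], EV R k H := by
    intro j
    induction j with
    | zero => intro k _ h H _ _ _; exact hr k (by omega) H
    | succ j ih =>
      intro k hk h H _ _ _
      exact bass_step d hd k hk (fun H _ _ _ => ih (k + 1) (by omega) (by omega) H) H inferInstance
  exact key (r + 1) k hk (by omega) H

end Bass

end TateSym

namespace TateSym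

section Complexes

variable {R}
variable {X : ℤ → Type u} [∀ i, AddCommGroup (X i)] [∀ i, Module R (X i)]

/-- Vanishing of the cohomology of `Hom(X, L)` at spot `b`. -/
def TV (d : ∀ i j, X i →ₗ[R] X j) (b : ℤ) (L : Type u) [AddCommGroup L] [Module R L] : Prop :=
  ∀ a c : ℤ, b + 1 = a → c + 1 = b → ∀ f : X b →ₗ[R] L, f ∘ₗ d a b = 0 →
    ∃ g : X c →ₗ[R] L, g ∘ₗ d b c = f

/-- Exactness of a complex at spot `b`. -/
def EX (d : ∀ i j, X i →ₗ[R] X j) (b : ℤ) : Prop :=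
  ∀ a c : ℤ, b + 1 = a → c + 1 = b → Function.Exact (d a b) (d b c)

/-- A totally acyclic complex of finite free modules. -/
structure TA (d : ∀ i j, X i →ₗ[R] X j) : Prop where
  ex : ∀ i, EX d i
  exd : ∀ i, TV d i R
  free : ∀ i, Module.Free R (X i)
  fin : ∀ i, Module.Finite R (X i)

lemma EX.dd {d : ∀ i j, X i →ₗ[R] X j} {b : ℤ} (h : EX d b) {a c : ℤ} (ha : b + 1 = a)
    (hc : c + 1 = b) (x : X a) : d b c (d a b x) = 0 :=
  (h a c ha hc).apply_apply_eq_zero x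

/-- Cokernel at spot `j`. -/
abbrev cok (d : ∀ i j, X i →ₗ[R] X j) (j : ℤ) : Type u := X j ⧸ LinearMap.range (d (j + 1) j)

/-- The inclusion of the cokernel at `j + 1` into `X j`. -/
def inc {d : ∀ i j, X i →ₗ[R] X j} {j : ℤ} (h : EX d (j + 1)) : cok d (j + 1) →ₗ[R] X j :=
  Submodule.liftQ _ (d (j + 1) j) (by
    rintro _ ⟨x, rfl⟩
    exact h.dd rfl rfl x)

lemma inc_mk {d : ∀ i j, X i →ₗ[R] X j} {j : ℤ} (h : EX d (j + 1)) (x : X (j + 1)) :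
    inc h (Submodule.Quotient.mk x) = d (j + 1) j x := rfl

lemma inc_injective {d : ∀ i j, X i →ₗ[R] X j} {j : ℤ} (h : EX d (j + 1)) :
    Function.Injective (inc h) := by
  rw [injective_iff_map_eq_zero]
  intro y hy
  obtain ⟨x, rfl⟩ := Submodule.Quotient.mk_surjective _ y
  rw [Submodule.Quotient.mk_eq_zero]
  exact (h _ _ rfl rfl x).1 hy

lemma inc_exact {d : ∀ i j, X i →ₗ[R] X j} {j : ℤ} (h : EX d (j + 1)) :
    Function.Exact (inc h) (LinearMap.range (d (j + 1) j)).mkQ := by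
  intro y
  rw [Submodule.mkQ_apply, Submodule.Quotient.mk_eq_zero]
  constructor
  · rintro ⟨x, rfl⟩
    exact ⟨Submodule.Quotient.mk x, rfl⟩
  · rintro ⟨z, rfl⟩
    obtain ⟨x, rfl⟩ := Submodule.Quotient.mk_surjective _ z
    exact ⟨x, rfl⟩

variable {d : ∀ i j, X i →ₗ[R] X j}

section
variable {L L' A F B : Type u} [AddCommGroup L] [Module R L] [AddCommGroup L'] [Module R L']
  [AddCommGroup A] [Module R A] [AddCommGroup B] [Module R B] [AddCommGroup F] [Module R F]

lemma TV.congr {i : ℤ} (e : L ≃ₗ[R] L') (h : TV d i L) : TV d i L' := by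
  intro a c ha hc f hf
  obtain ⟨g, hg⟩ := h a c ha hc (e.symm.toLinearMap ∘ₗ f) (by
    rw [LinearMap.comp_assoc, hf, LinearMap.comp_zero])
  refine ⟨e.toLinearMap ∘ₗ g, ?_⟩
  rw [LinearMap.comp_assoc, hg]
  ext x; simp

lemma TV.of_free (h : TA d) (i : ℤ) [Module.Free R L] [Module.Finite R L] : TV d i L := by
  let bas := Module.Free.chooseBasis R L
  refine TV.congr bas.equivFun.symm (L := Module.Free.ChooseBasisIndex R L → R) ?_
  intro a c ha hc f hf
  have : ∀ k, ∃ g : X c →ₗ[R] R, g ∘ₗ d i c = LinearMap.proj k ∘ₗ f := by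
    intro k
    exact h.exd i a c ha hc _ (by rw [LinearMap.comp_assoc, hf, LinearMap.comp_zero])
  choose g hg using this
  refine ⟨LinearMap.pi g, ?_⟩
  ext x k
  exact LinearMap.congr_fun (hg k) x

end

/-- Dimension shifting. -/
lemma TV.shift {A F B : Type u}
    [AddCommGroup A] [Module R A] [AddCommGroup B] [Module R B] [AddCommGroup F] [Module R F]
    (h : TA d) [Module.Free R F] [Module.Finite R F] {α : A →ₗ[R] F} {β : F →ₗ[R] B}
    (hex : Function.Exact α β) (hα : Function.Injective α) (hβ : Function.Surjective β) (i : ℤ) :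
    TV d i B ↔ TV d (i + 1) A := by
  have factor : ∀ (W : Type u) [AddCommGroup W] [Module R W] (k : W →ₗ[R] F), β ∘ₗ k = 0 →
      ∃ k' : W →ₗ[R] A, α ∘ₗ k' = k := by
    intro W _ _ k hk
    let e := LinearEquiv.ofInjective α hα
    have hmem : ∀ w, k w ∈ LinearMap.range α := fun w =>
      (hex _).1 (LinearMap.congr_fun hk w)
    refine ⟨e.symm.toLinearMap ∘ₗ k.codRestrict _ hmem, ?_⟩
    ext w
    have := congrArg Subtype.val (e.apply_symm_apply (k.codRestrict _ hmem w))
    exact this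
  have hβα : β ∘ₗ α = 0 := hex.linearMap_comp_eq_zero
  have hp : ∀ i, Module.Projective R (X i) := fun i => by
    have := h.free i
    infer_instance
  have hαc : ∀ (W : Type u) [AddCommGroup W] [Module R W] (k k' : W →ₗ[R] A),
      α ∘ₗ k = α ∘ₗ k' → k = k' := by
    intro W _ _ k k' hk
    ext w
    exact hα (LinearMap.congr_fun hk w)
  constructor
  · intro hB a c ha hc k hk
    have hc' : c = i := by omega
    subst hc'
    subst ha
    obtain ⟨e, he⟩ := TV.of_free (L := F) h (c + 1) _ c rfl rfl (α ∘ₗ k) (by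
      rw [LinearMap.comp_assoc, hk, LinearMap.comp_zero])
    obtain ⟨f, hf⟩ := hB (c + 1) (c - 1) rfl (by omega) (β ∘ₗ e) (by
      rw [LinearMap.comp_assoc, he, ← LinearMap.comp_assoc, hβα, LinearMap.zero_comp])
    have := hp (c - 1)
    obtain ⟨f', hf'⟩ := Module.projective_lifting_property β f hβ
    obtain ⟨g, hg⟩ := factor _ (e - f' ∘ₗ d c (c - 1)) (by
      rw [LinearMap.comp_sub, ← LinearMap.comp_assoc, hf', hf, sub_self])
    refine ⟨g, hαc _ _ _ ?_⟩
    rw [← LinearMap.comp_assoc, hg, LinearMap.sub_comp, he]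
    ext x
    simp [(h.ex c).dd rfl (by omega : c - 1 + 1 = c) x]
  · intro hA a c ha hc f hf
    subst ha
    subst hc
    have := hp (c + 1)
    obtain ⟨f', hf'⟩ := Module.projective_lifting_property β f hβ
    obtain ⟨k, hk⟩ := factor _ (f' ∘ₗ d (c + 1 + 1) (c + 1)) (by
      rw [← LinearMap.comp_assoc, hf', hf])
    obtain ⟨g, hg⟩ := hA (c + 1 + 1 + 1) (c + 1) rfl rfl k (hαc _ _ _ (by
      rw [← LinearMap.comp_assoc, hk]
      ext x
      simp [(h.ex (c + 1 + 1)).dd rfl rfl x]))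
    obtain ⟨e, he⟩ := TV.of_free (L := F) h (c + 1) _ c rfl rfl (f' - α ∘ₗ g) (by
      rw [LinearMap.sub_comp, LinearMap.comp_assoc, hg, hk, sub_self])
    refine ⟨β ∘ₗ e, ?_⟩
    rw [LinearMap.comp_assoc, he, LinearMap.comp_sub, hf', ← LinearMap.comp_assoc, hβα,
      LinearMap.zero_comp, sub_zero]

variable {Z : ℤ → Type u} [∀ i, AddCommGroup (Z i)] [∀ i, Module R (Z i)]
  {δ : ∀ i j, Z i →ₗ[R] Z j}

/-- Dimension shifting along a complex of finite free modules, exact above `j`. -/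
lemma TV.shift_cok (h : TA d) (j : ℤ) (hfree : ∀ i, Module.Free R (Z i))
    (hfin : ∀ i, Module.Finite R (Z i)) (hex : ∀ i, j < i → EX δ i) (n : ℕ) (i : ℤ) :
    ∀ i' j' : ℤ, i' = i + n → j' = j + n → (TV d i (cok δ j) ↔ TV d i' (cok δ j')) := by
  induction n with
  | zero =>
    intro i' j' hi hj
    obtain rfl : i' = i := by simpa using hi
    obtain rfl : j' = j := by simpa using hj
    rfl
  | succ n ih =>
    intro i' j' hi hj
    rw [ih _ _ rfl rfl]
    have := hfree (j + n)
    have := hfin (j + n)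
    have hE : EX δ (j + n + 1) := hex _ (by omega)
    obtain rfl : i' = i + n + 1 := by push_cast at hi; omega
    obtain rfl : j' = j + n + 1 := by push_cast at hj; omega
    exact TV.shift h (inc_exact hE) (inc_injective hE) (Submodule.mkQ_surjective _) _

/-- Vanishing only depends on the difference of the two indices. -/
lemma TV.diff (h : TA d) (hδ : TA δ) {i j i' j' : ℤ} (hij : i - j = i' - j') :
    TV d i (cok δ j) ↔ TV d i' (cok δ j') := by
  have aux : ∀ {i j i' j' : ℤ}, i - j = i' - j' → i ≤ i' →
      (TV d i (cok δ j) ↔ TV d i' (cok δ j')) := by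
    intro i j i' j' hij hle
    obtain ⟨n, rfl⟩ := Int.le.dest hle
    obtain rfl : j' = j + n := by omega
    exact TV.shift_cok h j hδ.free hδ.fin (fun i _ => hδ.ex i) n i _ _ rfl rfl
  rcases le_total i i' with hle | hle
  · exact aux hij hle
  · exact (aux hij.symm hle).symm

/-- The Hom complex `Hom(C, Z)`. -/
abbrev homD (C : Type u) [AddCommGroup C] [Module R C] (δ : ∀ i j, Z i →ₗ[R] Z j) (i j : ℤ) :
    (C →ₗ[R] Z i) →ₗ[R] (C →ₗ[R] Z j) := LinearMap.compRight R (δ i j)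

lemma EX.hom_of_TV (h : TA d) (hδ : TA δ) (j : ℤ) (hv : TV d 0 (cok δ (j + 1))) :
    EX (homD (cok d 0) δ) j := by
  intro a c ha hc
  subst ha
  intro k
  constructor
  swap
  · rintro ⟨k', rfl⟩
    ext x
    exact (hδ.ex j).dd rfl hc _
  intro hk
  have hk' : ∀ x, δ j c (k x) = 0 := fun x => LinearMap.congr_fun hk x
  have hE := hδ.ex (j + 1)
  -- factor k through cok (j+1)
  have hmem : ∀ x, k x ∈ LinearMap.range (inc hE) := fun x => by
    obtain ⟨y, hy⟩ := (hδ.ex j (j + 1) c rfl hc _).1 (hk' x)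
    exact ⟨Submodule.Quotient.mk y, hy⟩
  let e := LinearEquiv.ofInjective (inc hE) (inc_injective hE)
  let k1 : cok d 0 →ₗ[R] cok δ (j + 1) := e.symm.toLinearMap ∘ₗ k.codRestrict _ hmem
  have hk1 : ∀ x, inc hE (k1 x) = k x := fun x =>
    congrArg Subtype.val (e.apply_symm_apply (k.codRestrict _ hmem x))
  obtain ⟨g, hg⟩ := hv (0 + 1) (-1) rfl rfl (k1 ∘ₗ Submodule.mkQ _) (by
    ext x
    simp only [LinearMap.comp_apply, LinearMap.zero_apply]
    rw [show (LinearMap.range (d (0 + 1) 0)).mkQ (d (0 + 1) 0 x) = 0 by simp, map_zero])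
  have := h.free (-1)
  obtain ⟨g', hg'⟩ := Module.projective_lifting_property (Submodule.mkQ _) g
    (Submodule.mkQ_surjective (LinearMap.range (δ (j + 1 + 1) (j + 1))))
  have hE0 : EX d (-1 + 1) := h.ex _
  let i0 : cok d 0 →ₗ[R] X (-1) := inc (j := -1) hE0
  refine ⟨g' ∘ₗ i0, ?_⟩
  ext x
  change δ (j + 1) j (g' (d 0 (-1) x)) = k (Submodule.Quotient.mk x)
  rw [← hk1, ← inc_mk hE]
  congr 1
  have e1 := LinearMap.congr_fun hg x
  have e2 := LinearMap.congr_fun hg' (d 0 (-1) x)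
  exact e2.trans e1

/-- Extension of functionals. -/
lemma TV.of_EX (e : ℕ) (j : ℤ) (hfin : ∀ i, Module.Finite R (Z i))
    (hEV : ∀ k i, EV R (k + 1) (Z i))
    (hall : ∀ (H : Type u) [AddCommGroup H] [Module R H] [Module.Finite R H], EV R (e + 1) H)
    (hex : ∀ i : ℤ, i ≤ j → j - e ≤ i → EX δ i) : TV δ j R := by
  have hQ : ∀ m : ℕ, m ≤ e → EV R (e - m + 1) (cok δ (j - 1 - e + m)) := by
    intro m
    induction m with
    | zero => intro _; exact hall _
    | succ m ih =>
      intro hm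
      have hE : EX δ (j - 1 - e + m + 1) := hex _ (by omega) (by omega)
      have := ih (by omega)
      rw [show e - m + 1 = (e - (m + 1) + 1) + 1 by omega] at this
      have key := EV.left (inc_exact hE) (inc_injective hE) (Submodule.mkQ_surjective _)
        (hEV (e - (m + 1)) _) this
      rw [add_assoc] at key
      exact_mod_cast key
  have h1 : EV R 1 (cok δ (j - 1)) := by
    have := hQ e le_rfl
    rwa [Nat.sub_self, show (j - 1 - e + e : ℤ) = j - 1 by ring] at this
  intro a c ha hc f hf
  obtain rfl : c = j - 1 := by omega
  generalize hc' : j - 1 = c at *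
  obtain rfl : j = c + 1 := by omega
  subst ha
  have hE : EX δ (c + 1) := hex _ le_rfl (by omega)
  let φ : cok δ (c + 1) →ₗ[R] R := Submodule.liftQ _ f (by
    rintro _ ⟨x, rfl⟩
    exact LinearMap.congr_fun hf x)
  obtain ⟨ψ, hψ⟩ := EV.extend (inc_exact hE) (inc_injective hE) (Submodule.mkQ_surjective _) h1 φ
  refine ⟨ψ, ?_⟩
  ext x
  exact LinearMap.congr_fun hψ (Submodule.Quotient.mk x)

end Complexes

end TateSym

namespace TateSym

section Core

variable {R}

section Trace
variable {C F : Type u} [AddCommGroup C] [Module R C] [AddCommGroup F] [Module R F]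
  [Module.Free R F] [Module.Finite R F]

lemma trace_rank_one (g : F →ₗ[R] C) (ξ : C →ₗ[R] R) (z : F) :
    LinearMap.trace R F (ξ.smulRight z ∘ₗ g) = ξ (g z) := by
  have : ξ.smulRight z ∘ₗ g = (ξ ∘ₗ g).smulRight z := by ext x; simp
  rw [this, LinearMap.trace_smulRight]
  rfl

lemma trace_repr (hC : Function.Surjective (Module.Dual.eval R C)) (ψ : (C →ₗ[R] F) →ₗ[R] R) :
    ∃ g : F →ₗ[R] C, ∀ h : C →ₗ[R] F, ψ h = LinearMap.trace R F (h ∘ₗ g) := by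
  let b := Module.Free.chooseBasis R F
  have hc : ∀ i, ∃ c : C, ∀ ξ : C →ₗ[R] R, ξ c = ψ (ξ.smulRight (b i)) := by
    intro i
    obtain ⟨c, hc⟩ := hC (ψ ∘ₗ (LinearMap.smulRightₗ (R := R) (M₂ := C) (M := F)).flip (b i))
    refine ⟨c, fun ξ => ?_⟩
    have := LinearMap.congr_fun hc ξ
    exact this
  choose c hc using hc
  refine ⟨b.constr R c, fun h => ?_⟩
  have hh : h = ∑ i, (b.coord i ∘ₗ h).smulRight (b i) := by
    ext x
    simp [b.sum_repr]
  have hs : (∑ i, (b.coord i ∘ₗ h).smulRight (b i)) ∘ₗ b.constr R c =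
      ∑ i, ((b.coord i ∘ₗ h).smulRight (b i)) ∘ₗ b.constr R c :=
    map_sum (LinearMap.lcomp R F (b.constr R c)) _ _
  rw [hh, map_sum, hs, map_sum]
  refine Finset.sum_congr rfl fun i _ => ?_
  rw [trace_rank_one, ← hc, b.constr_basis]

lemma trace_inj (hC : Function.Injective (Module.Dual.eval R C)) (f f' : F →ₗ[R] C)
    (h : ∀ h : C →ₗ[R] F, LinearMap.trace R F (h ∘ₗ f) = LinearMap.trace R F (h ∘ₗ f')) :
    f = f' := by
  ext z
  apply hC
  ext ξ
  have := h (ξ.smulRight z)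
  rw [trace_rank_one, trace_rank_one] at this
  exact this

end Trace

variable {X : ℤ → Type u} [∀ i, AddCommGroup (X i)] [∀ i, Module R (X i)]
variable {d : ∀ i j, X i →ₗ[R] X j}

lemma refl_inj (h : TA d) (j : ℤ) : Function.Injective (Module.Dual.eval R (cok d j)) := by
  obtain ⟨k, rfl⟩ : ∃ k, j = k + 1 := ⟨j - 1, by omega⟩
  have := h.free k
  rw [injective_iff_map_eq_zero]
  intro x hx
  apply inc_injective (h.ex (k + 1))
  rw [map_zero]
  apply (Module.forall_dual_apply_eq_zero_iff R _).1
  intro ξ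
  exact LinearMap.congr_fun hx (ξ ∘ₗ inc (h.ex (k + 1)))

lemma ext_inc (h : TA d) (k : ℤ) (ξ : cok d (k + 1) →ₗ[R] R) :
    ∃ ψ : X k →ₗ[R] R, ψ ∘ₗ inc (h.ex (k + 1)) = ξ := by
  obtain ⟨g, hg⟩ := h.exd (k + 1) _ k rfl rfl (ξ ∘ₗ Submodule.mkQ _) (by
    ext x
    simp only [LinearMap.comp_apply, LinearMap.zero_apply]
    rw [show (LinearMap.range (d (k + 1 + 1) (k + 1))).mkQ (d (k + 1 + 1) (k + 1) x) = 0 by simp,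
      map_zero])
  refine ⟨g, ?_⟩
  ext x
  exact LinearMap.congr_fun hg x

lemma refl_surj (h : TA d) (j : ℤ) : Function.Surjective (Module.Dual.eval R (cok d j)) := by
  obtain ⟨k, rfl⟩ : ∃ k, j = k + 1 := ⟨j - 1, by omega⟩
  intro φ
  have := h.free k
  have := h.fin k
  have := h.free (k - 1)
  obtain ⟨t, ht⟩ := (Module.bijective_dual_eval R (X k)).2
    (φ ∘ₗ (inc (h.ex (k + 1))).dualMap)
  have ht' : ∀ ψ : X k →ₗ[R] R, ψ t = φ (ψ ∘ₗ inc (h.ex (k + 1))) := fun ψ =>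
    LinearMap.congr_fun ht ψ
  have hdt : d k (k - 1) t = 0 := by
    apply (Module.forall_dual_apply_eq_zero_iff R _).1
    intro ξ
    have e := ht' (ξ ∘ₗ d k (k - 1))
    have e0 : (ξ ∘ₗ d k (k - 1)) ∘ₗ inc (h.ex (k + 1)) = 0 := by
      ext x
      change ξ (d k (k - 1) (d (k + 1) k x)) = 0
      rw [(h.ex k).dd rfl (by omega), map_zero]
    rw [e0, map_zero] at e
    exact e
  obtain ⟨t0, rfl⟩ := (h.ex k (k + 1) (k - 1) rfl (by omega) t).1 hdt
  refine ⟨Submodule.Quotient.mk t0, ?_⟩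
  ext ξ
  obtain ⟨ψ, rfl⟩ := ext_inc h k ξ
  exact ht' ψ

lemma EV_dual (h : TA d) (k : ℕ) : ∀ j : ℤ, EV R (k + 1) (Module.Dual R (cok d j)) := by
  have ses : ∀ j : ℤ, Function.Exact ((LinearMap.range (d (j + 1) j)).mkQ.dualMap)
      ((inc (h.ex (j + 1))).dualMap) ∧
      Function.Injective ((LinearMap.range (d (j + 1) j)).mkQ.dualMap) ∧
      Function.Surjective ((inc (h.ex (j + 1))).dualMap) := by
    intro j
    refine ⟨?_, ?_, ?_⟩
    · intro ψ
      constructor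
      · intro hψ
        refine ⟨Submodule.liftQ _ ψ ?_, ?_⟩
        · rintro _ ⟨x, rfl⟩
          exact LinearMap.congr_fun hψ (Submodule.Quotient.mk x)
        · ext x; rfl
      · rintro ⟨ξ, rfl⟩
        ext x
        change ξ (Submodule.Quotient.mk (d (j + 1) j x)) = 0
        rw [(Submodule.Quotient.mk_eq_zero _).2 (LinearMap.mem_range_self _ x), map_zero]
    · exact LinearMap.dualMap_injective_of_surjective (Submodule.mkQ_surjective _)
    · intro ξ
      exact ext_inc h j ξ
  have hp : ∀ (k : ℕ) (j : ℤ), EV R (k + 1) (Module.Dual R (X j)) := by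
    intro k j
    have := h.free j
    have := h.fin j
    exact EV.of_projective k _
  induction k with
  | zero =>
    intro j
    obtain ⟨j, rfl⟩ : ∃ k, j = k + 1 := ⟨j - 1, by omega⟩
    obtain ⟨h1, h2, h3⟩ := ses j
    refine EV.of_extend h1 h2 h3 (hp 0 j) ?_
    intro φ
    obtain ⟨c, rfl⟩ := refl_surj h j φ
    obtain ⟨x, rfl⟩ := Submodule.Quotient.mk_surjective _ c
    exact ⟨Module.Dual.eval R _ x, rfl⟩
  | succ k ih =>
    intro j
    obtain ⟨j, rfl⟩ : ∃ k, j = k + 1 := ⟨j - 1, by omega⟩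
    obtain ⟨h1, h2, h3⟩ := ses j
    exact EV.right h1 h2 h3 (ih j) (hp _ j)

lemma EV_pi (k : ℕ) (H : Type u) [AddCommGroup H] [Module R H] (hH : EV R k H) (n : ℕ) :
    EV R k (Fin n → H) := by
  induction n with
  | zero => exact EV.of_subsingleton k _
  | succ n ih =>
    refine EV.congr (Fin.consLinearEquiv R (fun _ : Fin (n + 1) => H)) ?_
    exact EV.mid (Function.Exact.inl_snd) LinearMap.inl_injective Prod.snd_surjective hH ih

lemma EV_hom (h : TA d) (k : ℕ) (j : ℤ) (F : Type u) [AddCommGroup F] [Module R F]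
    [Module.Free R F] [Module.Finite R F] : EV R (k + 1) (cok d j →ₗ[R] F) := by
  let b0 := Module.Free.chooseBasis R F
  let b := b0.reindex (Fintype.equivFin _)
  let e1 : (Fin (Fintype.card (Module.Free.ChooseBasisIndex R F)) → Module.Dual R (cok d j)) ≃ₗ[R]
      (cok d j →ₗ[R] (Fin (Fintype.card (Module.Free.ChooseBasisIndex R F)) → R)) :=
    { toFun := fun f => LinearMap.pi f
      invFun := fun g i => LinearMap.proj i ∘ₗ g
      map_add' := fun _ _ => rfl
      map_smul' := fun _ _ => rfl
      left_inv := fun _ => rfl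
      right_inv := fun _ => rfl }
  exact EV.congr (e1.trans (LinearEquiv.congrRight b.equivFun.symm)) (EV_pi _ _ (EV_dual h k j) _)

variable {Z : ℤ → Type u} [∀ i, AddCommGroup (Z i)] [∀ i, Module R (Z i)]
  {δ : ∀ i j, Z i →ₗ[R] Z j}

lemma TV.of_hom [IsNoetherianRing R] (h : TA d) (hδ : TA δ) (e : ℕ) (j : ℤ)
    (hall : ∀ (H : Type u) [AddCommGroup H] [Module R H] [Module.Finite R H], EV R (e + 1) H)
    (hex : ∀ i : ℤ, i ≤ j → j - e ≤ i → EX (homD (cok d 0) δ) i) : TV δ j (cok d 0) := by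
  have := hδ.free
  have := hδ.fin
  have := h.fin
  have hv : TV (homD (cok d 0) δ) j R := TV.of_EX e j (fun i => inferInstance)
    (fun k i => EV_hom h k 0 (Z i)) hall hex
  intro a c ha hc f hf
  let φ : (cok d 0 →ₗ[R] Z j) →ₗ[R] R := LinearMap.trace R (Z j) ∘ₗ LinearMap.lcomp R (Z j) f
  obtain ⟨ψ, hψ⟩ := hv a c ha hc φ (by
    apply LinearMap.ext
    intro k
    change LinearMap.trace R (Z j) ((δ a j ∘ₗ k) ∘ₗ f) = 0
    rw [LinearMap.comp_assoc, LinearMap.trace_comp_comm', LinearMap.comp_assoc, hf,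
      LinearMap.comp_zero, map_zero])
  obtain ⟨g, hg⟩ := trace_repr (refl_surj h 0) ψ
  refine ⟨g, trace_inj (refl_inj h 0) _ _ ?_⟩
  intro k
  have e1 : ψ (δ j c ∘ₗ k) = LinearMap.trace R (Z j) (k ∘ₗ f) := LinearMap.congr_fun hψ k
  rw [← e1, hg, LinearMap.comp_assoc]
  exact (LinearMap.trace_comp_comm' (k ∘ₗ g) (δ j c)).symm

theorem core1 [IsNoetherianRing R] (h : TA d) (hδ : TA δ) (e : ℕ) (n : ℤ)
    (hall : ∀ (H : Type u) [AddCommGroup H] [Module R H] [Module.Finite R H], EV R (e + 1) H)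
    (hv : ∀ i, n ≤ i → TV d i (cok δ 0)) (i : ℤ) (hi : i < -n) : TV δ i (cok d 0) := by
  refine TV.of_hom h hδ e i hall fun j hj _ => ?_
  refine EX.hom_of_TV h hδ j ?_
  exact (TV.diff h hδ (by omega)).1 (hv (-(j + 1)) (by omega))

theorem core2 [IsNoetherianRing R] (h : TA d) (hδ : TA δ) (e : ℕ) (n : ℤ)
    (hall : ∀ (H : Type u) [AddCommGroup H] [Module R H] [Module.Finite R H], EV R (e + 1) H)
    (hv : ∀ i, i < n → TV d i (cok δ 0)) (i : ℤ) (hi : e - n ≤ i) : TV δ i (cok d 0) := by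
  refine TV.of_hom h hδ e i hall fun j hj hj' => ?_
  refine EX.hom_of_TV h hδ j ?_
  exact (TV.diff h hδ (by omega)).1 (hv (-(j + 1)) (by omega))

end Core

end TateSym

namespace TateSym

section Translate

variable {R}

/-- The differential of a chain complex of modules, as a linear map. -/
abbrev dd (K : ChainComplex (ModuleCat.{u} R) ℤ) (i j : ℤ) : K.X i →ₗ[R] K.X j := (K.d i j).hom

lemma exactAt_EX {K : ChainComplex (ModuleCat.{u} R) ℤ} {i : ℤ} (h : K.ExactAt i) :
    EX (dd K) i := by
  intro a c ha hc
  rw [K.exactAt_iff' a i c (by rw [ChainComplex.prev, ha])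
    (by rw [ChainComplex.next]; omega)] at h
  exact (ShortComplex.ShortExact.moduleCat_exact_iff_function_exact _).1 h

lemma yoneda_exact_iff (K : ChainComplex (ModuleCat.{u} R) ℤ) (L : Type u) [AddCommGroup L]
    [Module R L] (i : ℤ) :
    (K.linearYonedaObj R (ModuleCat.of R L)).ExactAt i ↔ TV (dd K) i L := by
  rw [HomologicalComplex.exactAt_iff' _ (i - 1) i (i + 1) (by rw [CochainComplex.prev])
    (by rw [CochainComplex.next]), ShortComplex.moduleCat_exact_iff]
  constructor
  · intro h a c ha hc f hf
    subst ha
    obtain rfl : c = i - 1 := by omega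
    obtain ⟨g, hg⟩ := h (ModuleCat.ofHom f) (by
      apply ModuleCat.hom_ext
      exact hf)
    exact ⟨g.hom, congrArg ModuleCat.Hom.hom hg⟩
  · intro h f hf
    obtain ⟨g, hg⟩ := h (i + 1) (i - 1) rfl (by omega) (ModuleCat.Hom.hom f)
      (congrArg ModuleCat.Hom.hom hf)
    exact ⟨ModuleCat.ofHom g, ModuleCat.hom_ext hg⟩

lemma tate_iff {M : ModuleCat.{u} R} (C : CompleteResolution R M) (L : Type u) [AddCommGroup L]
    [Module R L] (i : ℤ) : IsZero (TateExt R C (ModuleCat.of R L) i) ↔ TV (dd C.T) i L := by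
  rw [← yoneda_exact_iff, HomologicalComplex.exactAt_iff_isZero_homology]
  rfl

lemma free_of_proj [IsLocalRing R] (P : ModuleCat.{u} R) (h : Projective P)
    (hf : Module.Finite R P) : Module.Free R P := by
  have : Module.Projective R P := inferInstance
  exact Module.free_of_flat_of_isLocalRing

lemma ta_of [IsLocalRing R] {M : ModuleCat.{u} R} (C : CompleteResolution R M) : TA (dd C.T) where
  ex i := exactAt_EX (C.exactT i)
  exd i := (yoneda_exact_iff C.T R i).1 (C.exactTdual i)
  free i := free_of_proj _ (C.projT i) (C.fgT i)
  fin := C.fgT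

lemma mod_equiv {M : Type u} [AddCommGroup M] [Module R M]
    (C : CompleteResolution R (ModuleCat.of R M)) : Nonempty (cok (dd C.P) 0 ≃ₗ[R] M) := by
  have hs : Function.Surjective C.π.hom := (ModuleCat.epi_iff_surjective _).1 C.epiπ
  have he : LinearMap.range (dd C.P (0 + 1) 0) = LinearMap.ker C.π.hom :=
    (ShortComplex.moduleCat_exact_iff_range_eq_ker _).1 C.exact0
  exact ⟨(Submodule.quotEquivOfEq _ _ he).trans (C.π.hom.quotKerEquivOfSurjective hs)⟩

lemma cok_equiv {M : ModuleCat.{u} R} (C : CompleteResolution R M) (j : ℤ)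
    (h0 : IsIso (C.θ.f j)) (h1 : IsIso (C.θ.f (j + 1))) :
    Nonempty (cok (dd C.T) j ≃ₗ[R] cok (dd C.P) j) := by
  let e0 := (asIso (C.θ.f j)).toLinearEquiv
  let e1 := (asIso (C.θ.f (j + 1))).toLinearEquiv
  refine ⟨Submodule.Quotient.equiv _ _ e0 ?_⟩
  have hc : ∀ x, e0 (dd C.T (j + 1) j x) = dd C.P (j + 1) j (e1 x) := by
    intro x
    have := congrArg ModuleCat.Hom.hom (C.θ.comm (j + 1) j)
    exact (LinearMap.congr_fun this x).symm
  ext y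
  constructor
  · rintro ⟨_, ⟨x, rfl⟩, rfl⟩
    exact ⟨e1 x, (hc x).symm⟩
  · rintro ⟨x, rfl⟩
    refine ⟨_, ⟨e1.symm x, rfl⟩, ?_⟩
    refine (hc _).trans ?_
    rw [e1.apply_symm_apply]

lemma TV_mod_iff [IsLocalRing R] {X : ℤ → Type u} [∀ i, AddCommGroup (X i)]
    [∀ i, Module R (X i)] {d : ∀ i j, X i →ₗ[R] X j} (h : TA d)
    {M : Type u} [AddCommGroup M] [Module R M]
    (C : CompleteResolution R (ModuleCat.of R M)) (i : ℤ) :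
    TV d i M ↔ TV d i (cok (dd C.T) 0) := by
  obtain ⟨eM⟩ := mod_equiv C
  obtain ⟨n₀, hn₀⟩ := C.iso_eventually
  obtain ⟨e⟩ := cok_equiv C (n₀.toNat : ℤ) (hn₀ _ (by omega)) (hn₀ _ (by omega))
  have e1 : TV d i M ↔ TV d i (cok (dd C.P) 0) := ⟨TV.congr eM.symm, TV.congr eM⟩
  have e2 : TV d i (cok (dd C.P) 0) ↔ TV d (i + n₀.toNat) (cok (dd C.P) (n₀.toNat : ℤ)) :=
    TV.shift_cok h 0 (fun i => free_of_proj _ (C.projP i) (C.fgP i)) C.fgP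
      (fun i hi => exactAt_EX (C.exactP i hi)) n₀.toNat i _ _ rfl (zero_add _).symm
  have e3 : TV d (i + n₀.toNat) (cok (dd C.P) (n₀.toNat : ℤ)) ↔
      TV d (i + n₀.toNat) (cok (dd C.T) (n₀.toNat : ℤ)) := ⟨TV.congr e.symm, TV.congr e⟩
  rw [e1, e2, e3]
  exact TV.diff h (ta_of C) (by omega)

lemma EV_of_injDim {r : ℕ} (h : InjDimLE R (ModuleCat.of R R) r) (k : ℕ) (hk : r < k)
    (H : Type u) [AddCommGroup H] [Module R H] : EV R k H := by
  obtain ⟨I, ι, hI, hz, hmono, ⟨w, hex0⟩, hex⟩ := h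
  have hdd : ∀ i (x : I.X i), (I.d (i + 1) (i + 1 + 1)).hom ((I.d i (i + 1)).hom x) = 0 := by
    intro i x
    have := congrArg ModuleCat.Hom.hom (I.d_comp_d i (i + 1) (i + 1 + 1))
    exact LinearMap.congr_fun this x
  have claim : ∀ k i : ℕ, i + k = r + 1 →
      HasInjectiveDimensionLT (ModuleCat.of R (LinearMap.ker (I.d i (i + 1)).hom)) k := by
    intro k
    induction k with
    | zero =>
      intro i hi
      have hzz := hz i (by omega)
      have : Subsingleton (I.X i) := ModuleCat.subsingleton_of_isZero hzz
      have : Subsingleton (ModuleCat.of R (LinearMap.ker (I.d i (i + 1)).hom)) :=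
        inferInstanceAs (Subsingleton (LinearMap.ker (I.d i (i + 1)).hom))
      exact (ModuleCat.isZero_of_subsingleton _).hasInjectiveDimensionLT_zero
    | succ k ih =>
      intro i hi
      have h3 := ih (i + 1) (by omega)
      let g : I.X i →ₗ[R] LinearMap.ker (I.d (i + 1) (i + 1 + 1)).hom :=
        (I.d i (i + 1)).hom.codRestrict _ (fun x => hdd i x)
      have hgx : Function.Exact (LinearMap.ker (I.d i (i + 1)).hom).subtype g := by
        rw [LinearMap.exact_iff, Submodule.range_subtype]
        exact LinearMap.ker_codRestrict _ _ _
      have hg : Function.Surjective g := by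
        rintro ⟨y, hy⟩
        have := hex (i + 1) (by omega)
        rw [I.exactAt_iff' i (i + 1) (i + 1 + 1) (by simp) (by simp)] at this
        obtain ⟨x, hx⟩ :=
          ((ShortComplex.ShortExact.moduleCat_exact_iff_function_exact _).1 this y).1 hy
        exact ⟨x, Subtype.ext hx⟩
      have hS := sc_exact _ g hgx (Submodule.subtype_injective _) hg
      have h2 : HasInjectiveDimensionLT (I.X i) (k + 1) := by
        have := hI i
        exact hasInjectiveDimensionLT_of_ge _ 1 _ (by omega)
      exact hS.hasInjectiveDimensionLT_X₁ k h3 h2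
  have h0 := claim (r + 1) 0 (by omega)
  have hinj : Function.Injective ι.hom := (ModuleCat.mono_iff_injective ι).1 hmono
  have hr : LinearMap.range ι.hom = LinearMap.ker (I.d 0 (0 + 1)).hom :=
    (ShortComplex.moduleCat_exact_iff_range_eq_ker _).1 hex0
  let e : R ≃ₗ[R] LinearMap.ker (I.d 0 (0 + 1)).hom :=
    (LinearEquiv.ofInjective ι.hom hinj).trans (LinearEquiv.ofEq _ _ hr)
  have hR : HasInjectiveDimensionLT (ModuleCat.of R R) (r + 1) :=
    hasInjectiveDimensionLT_of_iso e.toModuleIso.symm _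
  exact ⟨fun a b => by
    rw [a.eq_zero_of_hasInjectiveDimensionLT (r + 1) hk,
      b.eq_zero_of_hasInjectiveDimensionLT (r + 1) hk]⟩

end Translate

end TateSym

/-- **Symmetry in vanishing of Tate cohomology over Gorenstein rings.**
Let `R` be a Gorenstein local ring of dimension `d`, let `M`, `N` be finitely generated
`R`-modules and `n` an integer. Then:
(i) if `Êxt^i_R(M,N) = 0` for all `i ≥ n`, then `Êxt^i_R(N,M) = 0` for all `i < -n`;
(ii) if `Êxt^i_R(M,N) = 0` for all `i < n`, then `Êxt^i_R(N,M) = 0` for all `i ≥ d - n`. -/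
theorem stmt_0 (R : Type) [CommRing R] (hR : IsGorensteinLocalRing R)
    (d : ℕ) (hd : ringKrullDim R = d)
    (M N : Type) [AddCommGroup M] [Module R M] [Module.Finite R M]
    [AddCommGroup N] [Module R N] [Module.Finite R N] (n : ℤ)
    (CM : CompleteResolution R (ModuleCat.of R M))
    (CN : CompleteResolution R (ModuleCat.of R N)) :
    ((∀ i : ℤ, n ≤ i → IsZero (TateExt R CM (ModuleCat.of R N) i)) →
      ∀ i : ℤ, i < -n → IsZero (TateExt R CN (ModuleCat.of R M) i)) ∧
    ((∀ i : ℤ, i < n → IsZero (TateExt R CM (ModuleCat.of R N) i)) →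
      ∀ i : ℤ, (d : ℤ) - n ≤ i → IsZero (TateExt R CN (ModuleCat.of R M) i)) := by
  obtain ⟨hloc, hnoeth, r, hr⟩ := hR
  have hall : ∀ (H : Type) [AddCommGroup H] [Module R H] [Module.Finite R H],
      TateSym.EV R (d + 1) H := by
    intro H _ _ _
    exact TateSym.bass d hd r (fun k hk H => TateSym.EV_of_injDim hr k hk H) (d + 1)
      (Nat.lt_succ_self d) H
  have hM := TateSym.ta_of CM
  have hN := TateSym.ta_of CN
  simp only [TateSym.tate_iff, TateSym.TV_mod_iff hM CN, TateSym.TV_mod_iff hN CM]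
  exact ⟨TateSym.core1 hM hN d n hall, TateSym.core2 hM hN d n hall⟩

end
end

section
/- Let R be a Gorenstein local ring and let M and N be finitely generated R-modules. Then: (i) Êxt^i_R(M,N) = 0 for all i ≫ 0 if and only if Êxt^i_R(N,M) = 0 for all i ≪ 0; (ii) Êxt^i_R(M,N) = 0 for all i ∈ ℤ if and only if Êxt^i_R(N,M) = 0 for all i ∈ ℤ. -/
open CategoryTheory CategoryTheory.Limits CategoryTheory.MonoidalCategory Opposite

noncomputable section

universe u

variable (R : Type u) [CommRing R]

section Helpers

/-- Cosyzygy data of a finite injective resolution of `R`. -/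
structure Cores (R : Type) [CommRing R] where
  K : ℕ → ModuleCat.{0} R
  I : ℕ → ModuleCat.{0} R
  ι : ∀ n, K n →ₗ[R] I n
  π : ∀ n, I n →ₗ[R] K (n + 1)
  ι_inj : ∀ n, Function.Injective (ι n)
  π_surj : ∀ n, Function.Surjective (π n)
  ex : ∀ n, Function.Exact (ι n) (π n)
  inj : ∀ n, Module.Injective R (I n)
  len : ℕ
  zero : ∀ n, len ≤ n → Subsingleton (K n)
  e : R ≃ₗ[R] K 0

/-- Syzygy data of a totally acyclic complex of finite free modules. -/
structure Syz (R : Type) [CommRing R] where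
  N : ℤ → ModuleCat.{0} R
  F : ℤ → ModuleCat.{0} R
  d : ∀ i j, F i →ₗ[R] F j
  ι : ∀ k, N (k + 1) →ₗ[R] F k
  π : ∀ k, F k →ₗ[R] N k
  dι : ∀ k, d (k + 1) k = ι k ∘ₗ π (k + 1)
  ι_inj : ∀ k, Function.Injective (ι k)
  π_surj : ∀ k, Function.Surjective (π k)
  ex : ∀ k, Function.Exact (ι k) (π k)
  free : ∀ k, Module.Free R (F k)
  fin : ∀ k, Module.Finite R (F k)
  ext : ∀ k (f : N (k + 1) →ₗ[R] R), ∃ g : F k →ₗ[R] R, g ∘ₗ ι k = f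

variable {R : Type} [CommRing R]

/-- Factor a map through a kernel inclusion. -/
theorem fac_of_exact {A B C D : Type} [AddCommGroup A] [AddCommGroup B] [AddCommGroup C]
    [AddCommGroup D] [Module R A] [Module R B] [Module R C] [Module R D]
    (i : A →ₗ[R] B) (p : B →ₗ[R] C) (hi : Function.Injective i) (h : Function.Exact i p)
    (f : D →ₗ[R] B) (hf : p ∘ₗ f = 0) : ∃ g : D →ₗ[R] A, i ∘ₗ g = f := by
  have hr : ∀ x, f x ∈ LinearMap.range i := fun x => (h (f x)).1 (LinearMap.congr_fun hf x)
  refine ⟨(LinearEquiv.ofInjective i hi).symm.toLinearMap ∘ₗ f.codRestrict _ hr, ?_⟩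
  ext x
  have := congrArg Subtype.val ((LinearEquiv.ofInjective i hi).apply_symm_apply
    (f.codRestrict _ hr x))
  exact this

/-- Factor a map through a cokernel projection. -/
theorem desc_of_ker {B C D : Type} [AddCommGroup B] [AddCommGroup C]
    [AddCommGroup D] [Module R B] [Module R C] [Module R D]
    (p : B →ₗ[R] C) (hp : Function.Surjective p)
    (f : B →ₗ[R] D) (hf : ∀ x, p x = 0 → f x = 0) : ∃ g : C →ₗ[R] D, g ∘ₗ p = f := by
  have hk : LinearMap.ker p ≤ LinearMap.ker f := fun x hx => hf x hx
  refine ⟨(LinearMap.ker p).liftQ f hk ∘ₗ (p.quotKerEquivOfSurjective hp).symm.toLinearMap, ?_⟩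
  ext x
  have : (p.quotKerEquivOfSurjective hp).symm (p x) = (LinearMap.ker p).mkQ x := by
    rw [LinearEquiv.symm_apply_eq]; rfl
  simp [this]

/-- Extend a map into an injective module. -/
theorem ext_of_inj {B C D : Type} [AddCommGroup B] [AddCommGroup C]
    [AddCommGroup D] [Module R B] [Module R C] [Module R D] (hD : Module.Injective R D)
    (p : B →ₗ[R] C) (f : B →ₗ[R] D) (hf : ∀ x, p x = 0 → f x = 0) :
    ∃ g : C →ₗ[R] D, g ∘ₗ p = f := by
  obtain ⟨g, hg⟩ := desc_of_ker p.rangeRestrict p.surjective_rangeRestrict f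
    (fun x hx => hf x (by simpa using congrArg Subtype.val hx))
  obtain ⟨h, hh⟩ := hD.out (LinearMap.range p).subtype (Submodule.injective_subtype _) g
  refine ⟨h, ?_⟩
  ext x
  rw [← hg]
  exact hh (p.rangeRestrict x)

/-- Maps into the cosyzygies lift: i.e. `Ext^i(X,R)=0` for `i>0`. -/
def Good (Q : Cores R) (X : Type) [AddCommGroup X] [Module R X] : Prop :=
  ∀ n (f : X →ₗ[R] Q.K (n + 1)), ∃ g : X →ₗ[R] Q.I n, Q.π n ∘ₗ g = f

theorem Good.of_proj (Q : Cores R) (X : Type) [AddCommGroup X] [Module R X]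
    [Module.Projective R X] : Good Q X := fun n f =>
  Module.projective_lifting_property (Q.π n) f (Q.π_surj n)

theorem Good.of_sum {Q : Cores R} {X Y : Type} [AddCommGroup X] [Module R X]
    [AddCommGroup Y] [Module R Y] (hX : Good Q X) {κ : Type} [Fintype κ]
    (r : κ → Y →ₗ[R] X) (s : κ → X →ₗ[R] Y) (h : ∀ y, ∑ i, s i (r i y) = y) : Good Q Y := by
  intro n f
  choose g hg using fun i => hX n (f ∘ₗ s i)
  refine ⟨∑ i, g i ∘ₗ r i, ?_⟩
  ext y
  have : ∀ i, Q.π n (g i (r i y)) = f (s i (r i y)) := fun i =>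
    LinearMap.congr_fun (hg i) (r i y)
  simp only [LinearMap.comp_apply, LinearMap.sum_apply, map_sum, this]
  rw [← map_sum, h]

theorem homEx (Q : Cores R) (σ : ℤ) (D : ℤ → Type) [∀ i, AddCommGroup (D i)]
    [∀ i, Module R (D i)] (d : ∀ i j, D i →ₗ[R] D j)
    (hd : ∀ i j k, j = i + σ → k = j + σ → d j k ∘ₗ d i j = 0) (hg : ∀ i, Good Q (D i))
    (U : ℕ → ℤ → Prop) (hU : ∀ r i, U (r + 1) i → U r (i + σ))
    (hex : ∀ r i j k, j = i + σ → k = j + σ → U (r + 1) j →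
      ∀ x, d j k x = 0 → ∃ y, d i j y = x) :
    ∀ r n, n + r = Q.len → ∀ i j k, j = i + σ → k = j + σ → U r j →
      ∀ f : D j →ₗ[R] Q.K n, f ∘ₗ d i j = 0 → ∃ g : D k →ₗ[R] Q.K n, g ∘ₗ d j k = f := by
  intro r
  induction r with
  | zero =>
    intro n hn i j k _ _ _ f _
    have := Q.zero n (by omega)
    exact ⟨0, by ext x; exact Subsingleton.elim _ _⟩
  | succ r ih =>
    intro n hn i j k hj hk hUj f hf
    obtain ⟨g, hgf⟩ := ext_of_inj (Q.inj n) (d j k) (Q.ι n ∘ₗ f) (by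
      intro x hx
      obtain ⟨y, rfl⟩ := hex r i j k hj hk hUj x hx
      have := LinearMap.congr_fun hf y
      simp only [LinearMap.comp_apply, LinearMap.zero_apply] at this ⊢
      rw [this, map_zero])
    have hz : (Q.π n ∘ₗ g) ∘ₗ d j k = 0 := by
      rw [LinearMap.comp_assoc, hgf, ← LinearMap.comp_assoc, (Q.ex n).linearMap_comp_eq_zero,
        LinearMap.zero_comp]
    obtain ⟨h, hh⟩ := ih (n + 1) (by omega) j k (k + σ) hk rfl (by rw [hk]; exact hU r j hUj)
      (Q.π n ∘ₗ g) hz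
    obtain ⟨h', hh'⟩ := hg (k + σ) n h
    obtain ⟨q, hq⟩ := fac_of_exact (Q.ι n) (Q.π n) (Q.ι_inj n) (Q.ex n)
      (g - h' ∘ₗ d k (k + σ)) (by
        rw [LinearMap.comp_sub, ← LinearMap.comp_assoc, hh', hh, sub_self])
    refine ⟨q, ?_⟩
    have h1 : Q.ι n ∘ₗ (q ∘ₗ d j k) = Q.ι n ∘ₗ f := by
      rw [← LinearMap.comp_assoc, hq, LinearMap.sub_comp, hgf, LinearMap.comp_assoc,
        hd j k (k + σ) hk rfl, LinearMap.comp_zero, sub_zero]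
    ext x
    exact Q.ι_inj n (LinearMap.congr_fun h1 x)

namespace Syz

variable (S T : Syz R)

theorem comp_zero (k : ℤ) : S.π k ∘ₗ S.ι k = 0 := (S.ex k).linearMap_comp_eq_zero

theorem dd (i j k : ℤ) (hj : j = i + -1) (hk : k = j + -1) : S.d j k ∘ₗ S.d i j = 0 := by
  obtain rfl : j = k + 1 := by omega
  obtain rfl : i = k + 1 + 1 := by omega
  rw [S.dι, S.dι, LinearMap.comp_assoc, ← LinearMap.comp_assoc (S.π (k+1+1)), S.comp_zero]
  simp

theorem d_apply (k : ℤ) (x : S.F (k + 1)) : S.d (k + 1) k x = S.ι k (S.π (k + 1) x) := by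
  rw [S.dι]; rfl

theorem d_zero {k : ℤ} {x : S.F (k + 1)} (h : S.d (k + 1) k x = 0) : S.π (k + 1) x = 0 := by
  rw [d_apply] at h
  exact S.ι_inj k (by rw [h, map_zero])

theorem comp_d_zero {X : Type} [AddCommGroup X] [Module R X] {k : ℤ} {f : S.F k →ₗ[R] X}
    (h : f ∘ₗ S.d (k + 1) k = 0) : ∃ g : S.N k →ₗ[R] X, g ∘ₗ S.π k = f := by
  apply desc_of_ker _ (S.π_surj k)
  intro x hx
  obtain ⟨y, rfl⟩ := (S.ex k x).1 hx
  obtain ⟨z, rfl⟩ := S.π_surj _ y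
  rw [← d_apply]
  exact LinearMap.congr_fun h z

theorem exD (i j k : ℤ) (hj : j = i + -1) (hk : k = j + -1) (x : S.F j) (hx : S.d j k x = 0) :
    ∃ y, S.d i j y = x := by
  obtain rfl : j = k + 1 := by omega
  obtain rfl : i = k + 1 + 1 := by omega
  obtain ⟨y, rfl⟩ := (S.ex _ x).1 (S.d_zero hx)
  obtain ⟨z, rfl⟩ := S.π_surj _ y
  exact ⟨z, S.d_apply _ z⟩

theorem pi_cancel {X : Type} [AddCommGroup X] [Module R X] {k : ℤ} {f g : S.N k →ₗ[R] X}
    (h : f ∘ₗ S.π k = g ∘ₗ S.π k) : f = g := by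
  ext x
  obtain ⟨y, rfl⟩ := S.π_surj k x
  exact LinearMap.congr_fun h y

theorem good_N (Q : Cores R) (k : ℤ) : Good Q (S.N k) := by
  obtain ⟨k, rfl⟩ : ∃ l, k = l + 1 := ⟨k - 1, by omega⟩
  intro n f
  by_cases hn : Q.len ≤ n + 1
  · have := Q.zero (n + 1) hn
    exact ⟨0, by ext x; exact Subsingleton.elim _ _⟩
  have hfree := S.free
  obtain ⟨g, hg⟩ := homEx Q (-1) (fun i => S.F i) S.d S.dd (fun i => Good.of_proj Q _)
    (fun _ _ => True) (fun _ _ _ => trivial) (fun _ i j k hj hk _ => S.exD i j k hj hk)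
    (Q.len - (n + 1)) (n + 1) (by omega) (k + 1 + 1) (k + 1) k (by omega) (by omega) trivial
    (f ∘ₗ S.π (k + 1)) (by
      rw [S.dι, LinearMap.comp_assoc, ← LinearMap.comp_assoc _ _ (S.π (k + 1)), S.comp_zero]
      simp)
  obtain ⟨g', hg'⟩ := Good.of_proj Q (S.F k) n g
  refine ⟨g' ∘ₗ S.ι k, ?_⟩
  rw [← LinearMap.comp_assoc, hg']
  apply S.pi_cancel
  rw [LinearMap.comp_assoc, ← S.dι, hg]

theorem exDual (i j k : ℤ) (hj : j = i + 1) (hk : k = j + 1) (x : Module.Dual R (S.F j))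
    (hx : (S.d k j).dualMap x = 0) : ∃ y, (S.d j i).dualMap y = x := by
  subst hj hk
  obtain ⟨g, rfl⟩ := S.comp_d_zero hx
  obtain ⟨h, rfl⟩ := S.ext i g
  exact ⟨h, by rw [S.dι]; rfl⟩

theorem good_dual (Q : Cores R) (k : ℤ) : Good Q (Module.Dual R (S.N k)) := by
  obtain ⟨k, rfl⟩ : ∃ l, k = l + 1 + 1 := ⟨k - 2, by omega⟩
  intro n f
  by_cases hn : Q.len ≤ n + 1
  · have := Q.zero (n + 1) hn
    exact ⟨0, by ext x; exact Subsingleton.elim _ _⟩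
  have hfree := S.free
  have hfin := S.fin
  have hdd : S.d (k + 1) k ∘ₗ S.ι (k + 1) = 0 := by
    rw [S.dι, LinearMap.comp_assoc, S.comp_zero, LinearMap.comp_zero]
  obtain ⟨g, hg⟩ := homEx Q 1 (fun i => Module.Dual R (S.F i)) (fun i j => (S.d j i).dualMap)
    (fun i j k hj hk => by
      rw [LinearMap.dualMap_comp_dualMap, S.dd k j i (by omega) (by omega)]
      ext x y
      exact map_zero x)
    (fun i => Good.of_proj Q _)
    (fun _ _ => True) (fun _ _ _ => trivial) (fun _ i j k hj hk _ => S.exDual i j k hj hk)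
    (Q.len - (n + 1)) (n + 1) (by omega) k (k + 1) (k + 1 + 1) (by omega) (by omega) trivial
    (f ∘ₗ (S.ι (k + 1)).dualMap) (by
      rw [LinearMap.comp_assoc, LinearMap.dualMap_comp_dualMap, hdd]
      ext x
      have h0 : (LinearMap.dualMap (0 : S.N (k + 1 + 1) →ₗ[R] S.F k)) x = 0 := by
        ext y
        exact map_zero x
      rw [LinearMap.comp_apply, h0, map_zero]
      rfl)
  obtain ⟨g', hg'⟩ := Good.of_proj Q (Module.Dual R (S.F (k + 1 + 1))) n g
  refine ⟨g' ∘ₗ (S.π (k + 1 + 1)).dualMap, ?_⟩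
  rw [← LinearMap.comp_assoc, hg']
  ext φ
  obtain ⟨ψ, rfl⟩ := S.ext _ φ
  have := LinearMap.congr_fun hg ψ
  rw [S.dι] at this
  exact this

theorem refl_inj (k : ℤ) (x : S.N k) (h : ∀ φ : S.N k →ₗ[R] R, φ x = 0) : x = 0 := by
  obtain ⟨k, rfl⟩ : ∃ l, k = l + 1 := ⟨k - 1, by omega⟩
  have hfree := S.free
  apply S.ι_inj k
  rw [map_zero]
  exact (Module.forall_dual_apply_eq_zero_iff R _).1 (fun φ => h (φ ∘ₗ S.ι k))

theorem refl_surj (k : ℤ) (φ : (S.N k →ₗ[R] R) →ₗ[R] R) : ∃ x : S.N k, ∀ ψ, φ ψ = ψ x := by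
  obtain ⟨k, rfl⟩ : ∃ l, k = l + 1 + 1 := ⟨k - 2, by omega⟩
  have hfree := S.free
  have hfin := S.fin
  obtain ⟨s, hs⟩ := (Module.bijective_dual_eval R (S.F (k + 1))).2
    (φ ∘ₗ (S.ι (k + 1)).dualMap)
  have hs' : ∀ ψ : S.F (k + 1) →ₗ[R] R, ψ s = φ (ψ ∘ₗ S.ι (k + 1)) := fun ψ =>
    LinearMap.congr_fun hs ψ
  have hds : S.d (k + 1) k s = 0 := by
    refine (Module.forall_dual_apply_eq_zero_iff R _).1 (fun ψ => ?_)
    have := hs' (ψ ∘ₗ S.d (k + 1) k)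
    rw [LinearMap.comp_assoc, S.dι, LinearMap.comp_assoc, S.comp_zero] at this
    simpa [S.dι] using this
  obtain ⟨x, rfl⟩ := (S.ex _ s).1 (S.d_zero hds)
  refine ⟨x, fun ψ => ?_⟩
  obtain ⟨χ, rfl⟩ := S.ext _ ψ
  exact (hs' χ).symm

/-- Vanishing of Tate cohomology with coefficients in `X` in degree `k+1`. -/
def V (X : Type) [AddCommGroup X] [Module R X] (k : ℤ) : Prop :=
  ∀ f : S.N (k + 1) →ₗ[R] X, ∃ g : S.F k →ₗ[R] X, g ∘ₗ S.ι k = f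

/-- Every map `X → N k` lifts to `F k`. -/
def Lift (X : Type) [AddCommGroup X] [Module R X] (k : ℤ) : Prop :=
  ∀ f : X →ₗ[R] S.N k, ∃ g : X →ₗ[R] S.F k, S.π k ∘ₗ g = f

theorem V_free (X : Type) [AddCommGroup X] [Module R X] [Module.Free R X] [Module.Finite R X]
    (k : ℤ) : S.V X k := by
  intro f
  let b := Module.Free.chooseBasis R X
  choose g hg using fun i => S.ext k (b.coord i ∘ₗ f)
  refine ⟨∑ i, (LinearMap.toSpanSingleton R X (b i)) ∘ₗ g i, ?_⟩
  ext x
  have : ∀ i, g i (S.ι k x) = b.coord i (f x) := fun i => LinearMap.congr_fun (hg i) x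
  simp only [LinearMap.comp_apply, LinearMap.sum_apply, this, LinearMap.toSpanSingleton_apply]
  exact b.sum_repr (f x)

theorem V_shift {X' P X : Type} [AddCommGroup X'] [Module R X'] [AddCommGroup P] [Module R P]
    [AddCommGroup X] [Module R X] [Module.Free R P] [Module.Finite R P]
    (i : X' →ₗ[R] P) (p : P →ₗ[R] X) (hi : Function.Injective i) (hp : Function.Surjective p)
    (h : Function.Exact i p) (k : ℤ) : S.V X k ↔ S.V X' (k + 1) := by
  have hfree := S.free
  constructor
  · intro hV f
    obtain ⟨g, hg⟩ := S.V_free P (k + 1) (i ∘ₗ f)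
    obtain ⟨q, hq⟩ := S.comp_d_zero (k := k + 1) (f := p ∘ₗ g) (by
      rw [S.dι, LinearMap.comp_assoc, ← LinearMap.comp_assoc _ _ g, hg, LinearMap.comp_assoc,
        ← LinearMap.comp_assoc, h.linearMap_comp_eq_zero, LinearMap.zero_comp])
    obtain ⟨e, he⟩ := hV q
    obtain ⟨e', he'⟩ := Module.projective_lifting_property p e hp
    obtain ⟨r, hr⟩ := fac_of_exact i p hi h (g - e' ∘ₗ S.d (k + 1) k) (by
      rw [LinearMap.comp_sub, ← LinearMap.comp_assoc, he', S.dι, ← LinearMap.comp_assoc, he, hq,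
        sub_self])
    refine ⟨r, ?_⟩
    have h1 : i ∘ₗ (r ∘ₗ S.ι (k + 1)) = i ∘ₗ f := by
      rw [← LinearMap.comp_assoc, hr, LinearMap.sub_comp, hg, S.dι, LinearMap.comp_assoc,
        LinearMap.comp_assoc, S.comp_zero, LinearMap.comp_zero, LinearMap.comp_zero, sub_zero]
    ext x
    exact hi (LinearMap.congr_fun h1 x)
  · intro hV f
    obtain ⟨g, hg⟩ := Module.projective_lifting_property p (f ∘ₗ S.π (k + 1)) hp
    obtain ⟨q, hq⟩ := fac_of_exact i p hi h (g ∘ₗ S.ι (k + 1)) (by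
      rw [← LinearMap.comp_assoc, hg, LinearMap.comp_assoc, S.comp_zero, LinearMap.comp_zero])
    obtain ⟨r, hr⟩ := hV q
    obtain ⟨s, hs⟩ := S.comp_d_zero (k := k + 1) (f := g - i ∘ₗ r) (by
      rw [S.dι, ← LinearMap.comp_assoc, LinearMap.sub_comp, LinearMap.comp_assoc, hr, hq,
        sub_self, LinearMap.zero_comp])
    obtain ⟨e, he⟩ := S.V_free P k s
    refine ⟨p ∘ₗ e, ?_⟩
    rw [LinearMap.comp_assoc, he]
    apply S.pi_cancel
    rw [LinearMap.comp_assoc, hs, LinearMap.comp_sub, hg, ← LinearMap.comp_assoc,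
      h.linearMap_comp_eq_zero, LinearMap.zero_comp, sub_zero]

theorem V_congr {X Y : Type} [AddCommGroup X] [Module R X] [AddCommGroup Y] [Module R Y]
    (e : X ≃ₗ[R] Y) (k : ℤ) (h : S.V X k) : S.V Y k := by
  intro f
  obtain ⟨g, hg⟩ := h (e.symm.toLinearMap ∘ₗ f)
  refine ⟨e.toLinearMap ∘ₗ g, ?_⟩
  rw [LinearMap.comp_assoc, hg]
  ext x
  simp

theorem V_iff {X Y : Type} [AddCommGroup X] [Module R X] [AddCommGroup Y] [Module R Y]
    (e : X ≃ₗ[R] Y) (k : ℤ) : S.V X k ↔ S.V Y k := ⟨S.V_congr e k, S.V_congr e.symm k⟩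

theorem V_N_succ (k l : ℤ) : S.V (T.N l) k ↔ S.V (T.N (l + 1)) (k + 1) := by
  have := T.free l
  have := T.fin l
  exact S.V_shift (T.ι l) (T.π l) (T.ι_inj l) (T.π_surj l) (T.ex l) k

theorem V_N_nat (k l : ℤ) (m : ℕ) : S.V (T.N l) k ↔ S.V (T.N (l + m)) (k + m) := by
  induction m with
  | zero => rw [Nat.cast_zero, add_zero, add_zero]
  | succ m ih =>
    rw [ih, V_N_succ]
    push_cast
    rw [add_assoc, add_assoc]

theorem V_N (k l k' l' : ℤ) (h : k' - k = l' - l) : S.V (T.N l) k ↔ S.V (T.N l') k' := by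
  rcases le_total k k' with hk | hk
  · obtain ⟨m, hm⟩ := Int.eq_ofNat_of_zero_le (sub_nonneg.2 hk)
    obtain rfl : k' = k + m := by omega
    obtain rfl : l' = l + m := by omega
    exact S.V_N_nat T k l m
  · obtain ⟨m, hm⟩ := Int.eq_ofNat_of_zero_le (sub_nonneg.2 hk)
    obtain rfl : k = k' + m := by omega
    obtain rfl : l = l' + m := by omega
    exact (S.V_N_nat T k' l' m).symm

theorem lift_iff (j k : ℤ) : T.Lift (S.N (j + 1)) k ↔ S.V (T.N k) j := by
  have h1 := S.free
  have h2 := T.free k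
  have h3 := T.fin k
  constructor
  · intro h f
    obtain ⟨g, rfl⟩ := h f
    obtain ⟨g', rfl⟩ := S.V_free (T.F k) j g
    exact ⟨T.π k ∘ₗ g', rfl⟩
  · intro h f
    obtain ⟨g, rfl⟩ := h f
    obtain ⟨g', rfl⟩ := Module.projective_lifting_property (T.π k) g (T.π_surj k)
    exact ⟨g' ∘ₗ S.ι j, rfl⟩

end Syz

section Pairing

variable {F X : Type} [AddCommGroup F] [Module R F] [Module.Free R F] [Module.Finite R F]
  [AddCommGroup X] [Module R X]

set_option linter.unusedSectionVars false

theorem tr_eq {κ : Type} [Fintype κ] (b : Module.Basis κ R F) (f : F →ₗ[R] F) :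
    LinearMap.trace R F f = ∑ i, b.coord i (f (b i)) := by
  classical
  rw [LinearMap.trace_eq_matrix_trace R b, Matrix.trace]
  simp [LinearMap.toMatrix_apply]

/-- The trace pairing. -/
def Phi (a : X →ₗ[R] F) : (F →ₗ[R] X) →ₗ[R] R :=
  LinearMap.trace R F ∘ₗ LinearMap.llcomp R F X F a

/-- The trace pairing, the other way. -/
def Psi (b : F →ₗ[R] X) : (X →ₗ[R] F) →ₗ[R] R :=
  LinearMap.trace R F ∘ₗ (LinearMap.llcomp R F X F).flip b

theorem Phi_apply (a : X →ₗ[R] F) (b : F →ₗ[R] X) :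
    Phi a b = LinearMap.trace R F (a ∘ₗ b) := rfl

theorem Psi_apply (a : X →ₗ[R] F) (b : F →ₗ[R] X) :
    Psi b a = LinearMap.trace R F (a ∘ₗ b) := rfl

theorem Phi_inj {a a' : X →ₗ[R] F} (h : ∀ b : F →ₗ[R] X, LinearMap.trace R F (a ∘ₗ b) =
    LinearMap.trace R F (a' ∘ₗ b)) : a = a' := by
  classical
  let b := Module.Free.chooseBasis R F
  ext x
  apply b.repr.injective
  ext i
  have := h ((LinearMap.toSpanSingleton R X x) ∘ₗ b.coord i)
  rw [tr_eq b, tr_eq b] at this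
  simpa [Finsupp.single_apply, ite_smul, apply_ite] using this

theorem Phi_surj (φ : (F →ₗ[R] X) →ₗ[R] R) : ∃ a : X →ₗ[R] F, ∀ b : F →ₗ[R] X,
    LinearMap.trace R F (a ∘ₗ b) = φ b := by
  classical
  let b := Module.Free.chooseBasis R F
  refine ⟨∑ i, LinearMap.toSpanSingleton R F (b i) ∘ₗ φ ∘ₗ LinearMap.smulRightₗ (b.coord i), ?_⟩
  intro f
  have hf : f = ∑ i, LinearMap.smulRightₗ (b.coord i) (f (b i)) := by
    apply b.ext
    intro j
    simp [Finsupp.single_apply, ite_smul]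
  rw [tr_eq b]
  conv_rhs => rw [hf, map_sum]
  simp [Finsupp.single_apply]

theorem Psi_inj (hX : ∀ x : X, (∀ φ : X →ₗ[R] R, φ x = 0) → x = 0) {b b' : F →ₗ[R] X}
    (h : ∀ a : X →ₗ[R] F, LinearMap.trace R F (a ∘ₗ b) =
    LinearMap.trace R F (a ∘ₗ b')) : b = b' := by
  classical
  let e := Module.Free.chooseBasis R F
  apply e.ext
  intro i
  rw [← sub_eq_zero]
  apply hX
  intro φ
  have := h ((LinearMap.toSpanSingleton R F (e i)) ∘ₗ φ)
  rw [tr_eq e, tr_eq e] at this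
  rw [map_sub, sub_eq_zero]
  simpa [Finsupp.single_apply] using this

theorem Psi_surj (hX : ∀ φ : (X →ₗ[R] R) →ₗ[R] R, ∃ x : X, ∀ ψ, φ ψ = ψ x)
    (φ : (X →ₗ[R] F) →ₗ[R] R) : ∃ b : F →ₗ[R] X, ∀ a : X →ₗ[R] F,
    LinearMap.trace R F (a ∘ₗ b) = φ a := by
  classical
  let e := Module.Free.chooseBasis R F
  choose x hx using fun i =>
    hX (φ ∘ₗ LinearMap.compRight R (LinearMap.toSpanSingleton R F (e i)))
  refine ⟨e.constr R x, ?_⟩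
  intro a
  have ha : a = ∑ i, LinearMap.toSpanSingleton R F (e i) ∘ₗ (e.coord i ∘ₗ a) := by
    ext y
    simp
  rw [tr_eq e]
  conv_rhs => rw [ha, map_sum]
  refine Finset.sum_congr rfl (fun i _ => ?_)
  have := hx i (e.coord i ∘ₗ a)
  simpa using this.symm

theorem good_hom_right (Q : Cores R) (h : Good Q X) : Good Q (F →ₗ[R] X) := by
  classical
  let e := Module.Free.chooseBasis R F
  refine h.of_sum (fun i => LinearMap.applyₗ (e i)) (fun i => LinearMap.smulRightₗ (e.coord i)) ?_
  intro f
  apply e.ext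
  intro j
  simp [Finsupp.single_apply, ite_smul]

theorem good_hom_left (Q : Cores R) (h : Good Q (Module.Dual R X)) : Good Q (X →ₗ[R] F) := by
  classical
  let e := Module.Free.chooseBasis R F
  refine h.of_sum (fun i => LinearMap.compRight R (e.coord i))
    (fun i => LinearMap.compRight R (LinearMap.toSpanSingleton R F (e i))) ?_
  intro a
  ext y
  simp

end Pairing

theorem homExR (Q : Cores R) (σ : ℤ) (D : ℤ → Type) [∀ i, AddCommGroup (D i)]
    [∀ i, Module R (D i)] (d : ∀ i j, D i →ₗ[R] D j)
    (hd : ∀ i j k, j = i + σ → k = j + σ → d j k ∘ₗ d i j = 0) (hg : ∀ i, Good Q (D i))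
    (U : ℕ → ℤ → Prop) (hU : ∀ r i, U (r + 1) i → U r (i + σ))
    (hex : ∀ r i j k, j = i + σ → k = j + σ → U (r + 1) j →
      ∀ x, d j k x = 0 → ∃ y, d i j y = x) (i j k : ℤ) (hj : j = i + σ) (hk : k = j + σ)
      (h : U Q.len j) (f : D j →ₗ[R] R) (hf : f ∘ₗ d i j = 0) :
      ∃ g : D k →ₗ[R] R, g ∘ₗ d j k = f := by
  obtain ⟨g, hgf⟩ := homEx Q σ D d hd hg U hU hex Q.len 0 (by omega) i j k hj hk h
    (Q.e.toLinearMap ∘ₗ f) (by rw [LinearMap.comp_assoc, hf, LinearMap.comp_zero])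
  refine ⟨Q.e.symm.toLinearMap ∘ₗ g, ?_⟩
  rw [LinearMap.comp_assoc, hgf]
  ext x
  simp

theorem dual_up (Q : Cores R) (T : Syz R) (X : Type) [AddCommGroup X] [Module R X]
    (hX : Good Q X) (U : ℕ → ℤ → Prop) (hU : ∀ r i, U (r + 1) i → U r (i + 1))
    (hV : ∀ r i, U (r + 1) (i + 1) → T.V X i) (j : ℤ) (hj : U Q.len j) : T.Lift X (j + 1) := by
  intro f
  have hfree := T.free
  have hfin := T.fin
  obtain ⟨j, rfl⟩ : ∃ l, j = l + 1 := ⟨j - 1, by omega⟩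
  obtain ⟨φ, hφ⟩ := homExR Q 1 (fun i => T.F i →ₗ[R] X) (fun i k => (T.d k i).lcomp R X)
    (fun i j k hj hk => by
      ext b x
      have := LinearMap.congr_fun (T.dd k j i (by omega) (by omega)) x
      simp only [LinearMap.comp_apply, LinearMap.zero_apply] at this
      simp [this])
    (fun i => good_hom_right Q hX) U hU
    (fun r i j k hj hk hr b hb => by
      subst hj hk
      obtain ⟨g, rfl⟩ := T.comp_d_zero hb
      obtain ⟨g', rfl⟩ := hV r i hr g
      refine ⟨g', ?_⟩
      change g' ∘ₗ T.d (i + 1) i = _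
      rw [T.dι, LinearMap.comp_assoc])
    j (j + 1) (j + 1 + 1) rfl rfl hj (Phi (T.ι (j + 1) ∘ₗ f)) (by
      ext b
      change LinearMap.trace R _ ((T.ι (j + 1) ∘ₗ f) ∘ₗ (b ∘ₗ T.d (j + 1) j)) = 0
      rw [← LinearMap.comp_assoc, LinearMap.trace_comp_comm', ← LinearMap.comp_assoc,
        ← LinearMap.comp_assoc, T.dι, LinearMap.comp_assoc (T.ι (j+1)), T.comp_zero]
      simp)
  obtain ⟨a, ha⟩ := Phi_surj φ
  have key : T.d (j + 1 + 1) (j + 1) ∘ₗ a = T.ι (j + 1) ∘ₗ f := by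
    apply Phi_inj
    intro b
    have h1 := LinearMap.congr_fun hφ b
    change φ (b ∘ₗ T.d (j + 1 + 1) (j + 1)) =
      LinearMap.trace R _ ((T.ι (j + 1) ∘ₗ f) ∘ₗ b) at h1
    rw [← h1, ← ha, LinearMap.comp_assoc, LinearMap.trace_comp_comm', LinearMap.comp_assoc]
  refine ⟨a, ?_⟩
  ext x
  apply T.ι_inj
  have := LinearMap.congr_fun key x
  rw [T.dι] at this
  exact this

theorem dual_down (Q : Cores R) (T : Syz R) (X : Type) [AddCommGroup X] [Module R X]
    (hX : Good Q (Module.Dual R X))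
    (hX1 : ∀ x : X, (∀ φ : X →ₗ[R] R, φ x = 0) → x = 0)
    (hX2 : ∀ φ : (X →ₗ[R] R) →ₗ[R] R, ∃ x : X, ∀ ψ, φ ψ = ψ x)
    (U : ℕ → ℤ → Prop) (hU : ∀ r i, U (r + 1) i → U r (i + -1))
    (hL : ∀ r i, U (r + 1) i → T.Lift X (i + 1)) (j : ℤ) (hj : U Q.len (j + 1)) : T.V X j := by
  intro f
  have hfree := T.free
  have hfin := T.fin
  obtain ⟨φ, hφ⟩ := homExR Q (-1) (fun i => X →ₗ[R] T.F i) (fun i k => (T.d i k).compRight R)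
    (fun i j k hj hk => by
      ext b x
      have := LinearMap.congr_fun (T.dd i j k (by omega) (by omega)) (b x)
      simp only [LinearMap.comp_apply, LinearMap.zero_apply] at this
      simp [this])
    (fun i => good_hom_left Q hX) U hU
    (fun r i j k hj hk hr a ha => by
      obtain rfl : j = k + 1 := by omega
      obtain rfl : i = k + 1 + 1 := by omega
      obtain ⟨g, rfl⟩ := fac_of_exact _ _ (T.ι_inj (k + 1)) (T.ex (k + 1)) a (by
        ext x
        exact T.d_zero (LinearMap.congr_fun ha x))
      obtain ⟨g', rfl⟩ := hL r (k + 1) hr g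
      refine ⟨g', ?_⟩
      change T.d (k + 1 + 1) (k + 1) ∘ₗ g' = _
      rw [T.dι, LinearMap.comp_assoc])
    (j + 1 + 1) (j + 1) j (by omega) (by omega) hj (Psi (f ∘ₗ T.π (j + 1))) (by
      ext a
      change LinearMap.trace R _ ((T.d (j + 1 + 1) (j + 1) ∘ₗ a) ∘ₗ (f ∘ₗ T.π (j + 1))) = 0
      rw [LinearMap.comp_assoc, LinearMap.trace_comp_comm', LinearMap.comp_assoc,
        LinearMap.comp_assoc, T.dι, ← LinearMap.comp_assoc _ _ (T.π (j+1)), T.comp_zero]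
      simp)
  obtain ⟨b, hb⟩ := Psi_surj hX2 φ
  have key : b ∘ₗ T.d (j + 1) j = f ∘ₗ T.π (j + 1) := by
    apply Psi_inj hX1
    intro a
    have h1 := LinearMap.congr_fun hφ a
    change φ (T.d (j + 1) j ∘ₗ a) =
      LinearMap.trace R _ (a ∘ₗ (f ∘ₗ T.π (j + 1))) at h1
    rw [← h1, ← hb, ← LinearMap.comp_assoc, LinearMap.trace_comp_comm', LinearMap.comp_assoc]
  refine ⟨b, ?_⟩
  apply T.pi_cancel
  rw [← key, T.dι, LinearMap.comp_assoc]

theorem abs_all (Q : Cores R) (S T : Syz R) (m n : ℤ) (h : ∀ k, T.V (S.N n) k) (k : ℤ) :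
    S.V (T.N m) k := by
  rw [S.V_N T k m (n - 1) (n - 1 - k + m) (by omega), ← Syz.lift_iff]
  have := dual_up Q T (S.N n) (S.good_N Q n) (fun _ _ => True) (fun _ _ _ => trivial)
    (fun _ i _ => h i) (n - 1 - k + m - 1) trivial
  rw [sub_add_cancel] at this
  rwa [sub_add_cancel]

theorem abs_up (Q : Cores R) (S T : Syz R) (m n : ℤ) (h : ∃ n₀, ∀ k, n₀ ≤ k → T.V (S.N n) k) :
    ∃ n₀, ∀ k, k ≤ n₀ → S.V (T.N m) k := by
  obtain ⟨n₀, h⟩ := h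
  refine ⟨n - 1 + m - n₀ - 2, fun k hk => ?_⟩
  rw [S.V_N T k m (n - 1) (n - 1 - k + m) (by omega), ← Syz.lift_iff]
  have := dual_up Q T (S.N n) (S.good_N Q n) (fun _ i => n₀ + 1 ≤ i)
    (fun _ _ _ => by omega)
    (fun _ i hi => h i (by omega)) (n - 1 - k + m - 1) (by omega)
  rw [sub_add_cancel] at this
  rwa [sub_add_cancel]

theorem abs_down (Q : Cores R) (S T : Syz R) (m n : ℤ) (h : ∃ n₀, ∀ k, k ≤ n₀ → S.V (T.N m) k) :
    ∃ n₀, ∀ k, n₀ ≤ k → T.V (S.N n) k := by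
  obtain ⟨n₀, h⟩ := h
  refine ⟨n - 1 + m - n₀ + Q.len, fun k hk => ?_⟩
  refine dual_down Q T (S.N n) (S.good_dual Q n) (S.refl_inj n) (S.refl_surj n)
    (fun r i => n - 1 + m - n₀ + r ≤ i + 1)
    (fun _ _ _ => by push_cast at *; omega) (fun r i hi => ?_) k
    (by omega)
  have := h (n - 1 + m - (i + 1)) (by push_cast at hi; omega)
  rw [S.V_N T _ m (n - 1) (i + 1) (by omega), ← Syz.lift_iff] at this
  rwa [sub_add_cancel] at this

end Helpers

section Concrete

variable {R : Type} [CommRing R]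

/-- The underlying linear map. -/
def homOf {A B : ModuleCat.{0} R} (f : A ⟶ B) : A →ₗ[R] B := f.hom

theorem chainEx (T : ChainComplex (ModuleCat.{0} R) ℤ) (k : ℤ) (h : T.ExactAt (k + 1))
    (x : T.X (k + 1)) (hx : (T.d (k + 1) k).hom x = 0) :
    ∃ y, (T.d (k + 1 + 1) (k + 1)).hom y = x := by
  rw [T.exactAt_iff' (k + 1 + 1) (k + 1) k
    (ComplexShape.prev_eq' _ rfl) (ComplexShape.next_eq' _ rfl),
    ShortComplex.moduleCat_exact_iff] at h
  exact h x hx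

theorem yonedaEx (T : ChainComplex (ModuleCat.{0} R) ℤ) (X : ModuleCat.{0} R) (k : ℤ) :
    (T.linearYonedaObj R X).ExactAt (k + 1) ↔
      ∀ f : T.X (k + 1) →ₗ[R] X, f ∘ₗ (T.d (k + 1 + 1) (k + 1)).hom = 0 →
        ∃ g : T.X k →ₗ[R] X, g ∘ₗ (T.d (k + 1) k).hom = f := by
  rw [(T.linearYonedaObj R X).exactAt_iff' k (k + 1) (k + 1 + 1)
    (ComplexShape.prev_eq' _ rfl) (ComplexShape.next_eq' _ rfl),
    ShortComplex.moduleCat_exact_iff]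
  constructor
  · intro h f hf
    obtain ⟨g, hg⟩ := h (ModuleCat.ofHom f) (ModuleCat.hom_ext hf)
    exact ⟨homOf (A := T.X k) (B := X) g,
      congrArg (homOf (A := T.X (k + 1)) (B := X)) hg⟩
  · intro h f hf
    obtain ⟨g, hg⟩ := h (homOf (A := T.X (k + 1)) (B := X) f)
      (congrArg (homOf (A := T.X (k + 1 + 1)) (B := X)) hf)
    exact ⟨ModuleCat.ofHom g, ModuleCat.hom_ext hg⟩

/-- The cokernel of `d : T (k+1) → T k`. -/
abbrev Cok (T : ChainComplex (ModuleCat.{0} R) ℤ) (k : ℤ) : ModuleCat.{0} R :=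
  ModuleCat.of R (T.X k ⧸ LinearMap.range (T.d (k + 1) k).hom)

/-- The map from the cokernel. -/
def cokι (T : ChainComplex (ModuleCat.{0} R) ℤ) (k : ℤ) : Cok T (k + 1) →ₗ[R] T.X k :=
  Submodule.liftQ _ (T.d (k + 1) k).hom (by
    rintro _ ⟨y, rfl⟩
    exact LinearMap.congr_fun (congrArg ModuleCat.Hom.hom (T.d_comp_d (k + 1 + 1) (k + 1) k)) y)

/-- The projection to the cokernel. -/
def cokπ (T : ChainComplex (ModuleCat.{0} R) ℤ) (k : ℤ) : T.X k →ₗ[R] Cok T k :=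
  Submodule.mkQ _

theorem cokd (T : ChainComplex (ModuleCat.{0} R) ℤ) (k : ℤ) :
    (T.d (k + 1) k).hom = cokι T k ∘ₗ cokπ T (k + 1) := by
  ext x; rfl

theorem cokπ_surj (T : ChainComplex (ModuleCat.{0} R) ℤ) (k : ℤ) :
    Function.Surjective (cokπ T k) := Submodule.mkQ_surjective _

theorem cok_ex (T : ChainComplex (ModuleCat.{0} R) ℤ) (k : ℤ) :
    Function.Exact (cokι T k) (cokπ T k) := by
  intro x
  have h1 : cokπ T k x = 0 ↔ x ∈ LinearMap.range (T.d (k + 1) k).hom :=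
    Submodule.Quotient.mk_eq_zero _
  rw [h1]
  constructor
  · rintro ⟨y, rfl⟩
    exact ⟨cokπ T (k + 1) y, rfl⟩
  · rintro ⟨y, rfl⟩
    obtain ⟨y, rfl⟩ := cokπ_surj T (k + 1) y
    exact ⟨y, rfl⟩

theorem cokι_inj (T : ChainComplex (ModuleCat.{0} R) ℤ) (k : ℤ) (h : T.ExactAt (k + 1)) :
    Function.Injective (cokι T k) := by
  rw [injective_iff_map_eq_zero]
  intro y hy
  obtain ⟨y, rfl⟩ := cokπ_surj T (k + 1) y
  obtain ⟨z, rfl⟩ := chainEx T k h y hy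
  exact (Submodule.Quotient.mk_eq_zero _).2 ⟨z, rfl⟩

theorem free_of (hR : IsLocalRing R) (X : ModuleCat.{0} R) (h : Projective X)
    (hf : Module.Finite R X) : Module.Free R X := by
  have : Module.Projective R X := (IsProjective.iff_projective X).2 h
  exact Module.free_of_flat_of_isLocalRing

theorem cok_ext (T : ChainComplex (ModuleCat.{0} R) ℤ) (X : ModuleCat.{0} R) (k : ℤ) :
    (T.linearYonedaObj R X).ExactAt (k + 1) ↔
      ∀ f : Cok T (k + 1) →ₗ[R] X, ∃ g : T.X k →ₗ[R] X, g ∘ₗ cokι T k = f := by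
  rw [yonedaEx]
  constructor
  · intro h f
    obtain ⟨g, hg⟩ := h (f ∘ₗ cokπ T (k + 1)) (by
      ext x
      have h0 : cokπ T (k + 1) ((T.d (k + 1 + 1) (k + 1)).hom x) = 0 :=
        (Submodule.Quotient.mk_eq_zero _).2 ⟨x, rfl⟩
      change f (cokπ T (k + 1) ((T.d (k + 1 + 1) (k + 1)).hom x)) = 0
      rw [h0, map_zero])
    refine ⟨g, ?_⟩
    ext x
    exact LinearMap.congr_fun hg x
  · intro h f hf
    obtain ⟨f', rfl⟩ := desc_of_ker (cokπ T (k + 1)) (cokπ_surj T (k + 1)) f (by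
      intro x hx
      obtain ⟨y, rfl⟩ := (Submodule.Quotient.mk_eq_zero _).1 hx
      exact LinearMap.congr_fun hf y)
    obtain ⟨g, rfl⟩ := h f'
    exact ⟨g, by rw [cokd, LinearMap.comp_assoc]⟩

/-- The syzygy data of a complete resolution. -/
def syzOf (hR : IsLocalRing R) {M : ModuleCat.{0} R} (C : CompleteResolution R M) : Syz R where
  N := Cok C.T
  F := C.T.X
  d i j := (C.T.d i j).hom
  ι := cokι C.T
  π := cokπ C.T
  dι := cokd C.T
  ι_inj k := cokι_inj C.T k (C.exactT _)
  π_surj := cokπ_surj C.T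
  ex := cok_ex C.T
  free k := free_of hR _ (C.projT k) (C.fgT k)
  fin := C.fgT
  ext k := (cok_ext C.T (ModuleCat.of R R) k).1 (C.exactTdual (k + 1))

theorem tate_iff (hR : IsLocalRing R) {M : ModuleCat.{0} R} (C : CompleteResolution R M)
    (X : ModuleCat.{0} R) (k : ℤ) :
    IsZero (TateExt R C X (k + 1)) ↔ (syzOf hR C).V X k := by
  rw [TateExt, ← HomologicalComplex.exactAt_iff_isZero_homology]
  exact cok_ext C.T X k

theorem V_res_nat (hR : IsLocalRing R) {M : ModuleCat.{0} R} (C : CompleteResolution R M)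
    (S : Syz R) (k : ℤ) (m : ℕ) : S.V M k ↔ S.V (Cok C.P m) (k + m) := by
  induction m with
  | zero =>
    have hs : Function.Surjective C.π.hom := (ModuleCat.epi_iff_surjective _).1 C.epiπ
    have hk : LinearMap.range (C.P.d (0 + 1) 0).hom = LinearMap.ker C.π.hom :=
      (ShortComplex.moduleCat_exact_iff_range_eq_ker _).1 C.exact0
    rw [Nat.cast_zero, add_zero]
    exact S.V_iff ((Submodule.quotEquivOfEq _ _ hk).trans
      (C.π.hom.quotKerEquivOfSurjective hs)).symm k
  | succ m ih =>
    have := free_of hR _ (C.projP m) (C.fgP m)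
    have := C.fgP m
    rw [ih, S.V_shift (cokι C.P m) (cokπ C.P m) (cokι_inj C.P m (C.exactP _ (by omega)))
      (cokπ_surj C.P m) (cok_ex C.P m)]
    rw [Nat.cast_succ, add_assoc k (m : ℤ) 1]

theorem V_res (hR : IsLocalRing R) {M : ModuleCat.{0} R} (C : CompleteResolution R M) :
    ∃ m : ℤ, ∀ (S : Syz R) (k : ℤ), S.V M k ↔ S.V ((syzOf hR C).N m) (k + m) := by
  obtain ⟨n, hn⟩ := C.iso_eventually
  refine ⟨(n.toNat : ℤ), fun S k => ?_⟩
  rw [V_res_nat hR C S k n.toNat]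
  generalize hm : (n.toNat : ℤ) = m
  have hm' : n ≤ m := by omega
  have i1 := hn m hm'
  have i2 := hn (m + 1) (by omega)
  let e1 := (asIso (C.θ.f m)).toLinearEquiv
  let e2 := (asIso (C.θ.f (m + 1))).toLinearEquiv
  have hc : ∀ x, e1 ((C.T.d (m + 1) m).hom x) = (C.P.d (m + 1) m).hom (e2 x) := fun x =>
    (LinearMap.congr_fun (congrArg ModuleCat.Hom.hom (C.θ.comm (m + 1) m)) x).symm
  refine (S.V_iff (Submodule.Quotient.equiv _ _ e1 ?_) _).symm
  ext y
  constructor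
  · rintro ⟨_, ⟨x, rfl⟩, rfl⟩
    exact ⟨e2 x, (hc x).symm⟩
  · rintro ⟨x, rfl⟩
    refine ⟨_, ⟨e2.symm x, rfl⟩, ?_⟩
    have := hc (e2.symm x)
    rw [e2.apply_symm_apply] at this
    exact this

theorem coresOf (h : HasFiniteInjDim R (ModuleCat.of R R)) : Nonempty (Cores R) := by
  obtain ⟨n, I, ι, hI, hz, hmono, ⟨w, hex0⟩, hex⟩ := h
  have hι : Function.Injective ι.hom := (ModuleCat.mono_iff_injective _).1 hmono
  have h0 : LinearMap.range ι.hom = LinearMap.ker (I.d 0 1).hom :=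
    (ShortComplex.moduleCat_exact_iff_range_eq_ker _).1 hex0
  have hdd : ∀ n (x : I.X n), (I.d (n + 1) (n + 1 + 1)).hom ((I.d n (n + 1)).hom x) = 0 :=
    fun n x => LinearMap.congr_fun
      (congrArg ModuleCat.Hom.hom (I.d_comp_d n (n + 1) (n + 1 + 1))) x
  refine ⟨{
    K := fun n => ModuleCat.of R (LinearMap.ker (I.d n (n + 1)).hom)
    I := fun n => I.X n
    ι := fun n => Submodule.subtype _
    π := fun n => (I.d n (n + 1)).hom.codRestrict _ (fun x => hdd n x)
    ι_inj := fun n => Submodule.injective_subtype _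
    π_surj := ?_
    ex := ?_
    inj := fun n => Module.injective_module_of_injective_object R (I.X n) (inj := hI n)
    len := n + 1
    zero := ?_
    e := (LinearEquiv.ofInjective ι.hom hι).trans (LinearEquiv.ofEq _ _ h0) }⟩
  · rintro n ⟨y, hy⟩
    have := hex (n + 1) (by omega)
    rw [I.exactAt_iff' n (n + 1) (n + 1 + 1)
      (ComplexShape.prev_eq' _ rfl) (ComplexShape.next_eq' _ rfl),
      ShortComplex.moduleCat_exact_iff] at this
    obtain ⟨x, hx⟩ := this y hy
    exact ⟨x, Subtype.ext hx⟩
  · intro n x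
    constructor
    · intro hx
      exact ⟨⟨x, congrArg Subtype.val hx⟩, rfl⟩
    · rintro ⟨⟨y, hy⟩, rfl⟩
      exact Subtype.ext hy
  · intro m hm
    have : Subsingleton (I.X m) := ModuleCat.subsingleton_of_isZero (hz m (by omega))
    exact inferInstanceAs (Subsingleton (LinearMap.ker (I.d m (m + 1)).hom))

end Concrete

/-- Let `R` be a Gorenstein local ring and `M`, `N` finitely generated `R`-modules. Then:
(i) `Êxt^i_R(M,N) = 0` for all `i ≫ 0` iff `Êxt^i_R(N,M) = 0` for all `i ≪ 0`;
(ii) `Êxt^i_R(M,N) = 0` for all `i ∈ ℤ` iff `Êxt^i_R(N,M) = 0` for all `i ∈ ℤ`. -/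
theorem stmt_1 (R : Type) [CommRing R] (hR : IsGorensteinLocalRing R)
    (M N : Type) [AddCommGroup M] [Module R M] [Module.Finite R M]
    [AddCommGroup N] [Module R N] [Module.Finite R N]
    (CM : CompleteResolution R (ModuleCat.of R M))
    (CN : CompleteResolution R (ModuleCat.of R N)) :
    ((∃ n₀ : ℤ, ∀ i : ℤ, n₀ ≤ i → IsZero (TateExt R CM (ModuleCat.of R N) i)) ↔
      (∃ n₀ : ℤ, ∀ i : ℤ, i ≤ n₀ → IsZero (TateExt R CN (ModuleCat.of R M) i))) ∧
    ((∀ i : ℤ, IsZero (TateExt R CM (ModuleCat.of R N) i)) ↔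
      (∀ i : ℤ, IsZero (TateExt R CN (ModuleCat.of R M) i))) := by
  obtain ⟨hloc, -, hinj⟩ := hR
  obtain ⟨Q⟩ := coresOf hinj
  obtain ⟨m, hm⟩ := V_res hloc CM
  obtain ⟨n, hn⟩ := V_res hloc CN
  have hM : ∀ i, IsZero (TateExt R CM (ModuleCat.of R N) i) ↔
      (syzOf hloc CM).V ((syzOf hloc CN).N n) (i - 1 + n) := fun i => by
    rw [← hn, ← tate_iff, sub_add_cancel]
  have hN : ∀ i, IsZero (TateExt R CN (ModuleCat.of R M) i) ↔
      (syzOf hloc CN).V ((syzOf hloc CM).N m) (i - 1 + m) := fun i => by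
    rw [← hm, ← tate_iff, sub_add_cancel]
  simp only [hM, hN]
  have a1 : ∀ {P : ℤ → Prop} {c : ℤ}, (∃ n₀ : ℤ, ∀ i : ℤ, n₀ ≤ i → P (i - 1 + c)) ↔
      ∃ n₀ : ℤ, ∀ i : ℤ, n₀ ≤ i → P i := by
    intro P c
    constructor
    · rintro ⟨n₀, h⟩
      refine ⟨n₀ - 1 + c, fun i hi => ?_⟩
      have := h (i + 1 - c) (by omega)
      rwa [show i + 1 - c - 1 + c = i by omega] at this
    · rintro ⟨n₀, h⟩
      exact ⟨n₀ + 1 - c, fun i hi => h _ (by omega)⟩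
  have a2 : ∀ {P : ℤ → Prop} {c : ℤ}, (∃ n₀ : ℤ, ∀ i : ℤ, i ≤ n₀ → P (i - 1 + c)) ↔
      ∃ n₀ : ℤ, ∀ i : ℤ, i ≤ n₀ → P i := by
    intro P c
    constructor
    · rintro ⟨n₀, h⟩
      refine ⟨n₀ - 1 + c, fun i hi => ?_⟩
      have := h (i + 1 - c) (by omega)
      rwa [show i + 1 - c - 1 + c = i by omega] at this
    · rintro ⟨n₀, h⟩
      exact ⟨n₀ + 1 - c, fun i hi => h _ (by omega)⟩
  have a3 : ∀ {P : ℤ → Prop} {c : ℤ}, (∀ i : ℤ, P (i - 1 + c)) ↔ ∀ i : ℤ, P i := by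
    intro P c
    constructor
    · intro h i
      have := h (i + 1 - c)
      rwa [show i + 1 - c - 1 + c = i by omega] at this
    · intro h i
      exact h _
  rw [a1 (P := fun i => (syzOf hloc CM).V ((syzOf hloc CN).N n) i),
    a2 (P := fun i => (syzOf hloc CN).V ((syzOf hloc CM).N m) i),
    a3 (P := fun i => (syzOf hloc CM).V ((syzOf hloc CN).N n) i),
    a3 (P := fun i => (syzOf hloc CN).V ((syzOf hloc CM).N m) i)]
  exact ⟨⟨abs_up Q _ _ m n, abs_down Q _ _ m n⟩, ⟨abs_all Q _ _ m n, abs_all Q _ _ n m⟩⟩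


end
end

section
/- Let (R, m, k) be a local ring and let M and N be finitely generated R-modules with G-dim_R(M) < ∞. Then Êxt^i_R(M, N^∨) ≅ (T̂or_i^R(M,N))^∨ for all i ∈ ℤ, where (−)^∨ = Hom_R(−, E_R(k)) is Matlis duality with respect to the injective envelope E_R(k) of the residue field k. -/
open CategoryTheory CategoryTheory.Limits CategoryTheory.MonoidalCategory Opposite

noncomputable section

universe u

variable (R : Type u) [CommRing R]

/-- `Hom(-, E)` preserves homology when `E` is injective. -/
theorem linYonedaPreservesHomology (R : Type u) [CommRing R] (E : ModuleCat.{u} R)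
    (hE : Injective E) : ((linearYoneda R (ModuleCat.{u} R)).obj E).PreservesHomology := by
  apply Functor.preservesHomology_of_map_exact
  intro S hS
  rw [ShortComplex.moduleCat_exact_iff]
  intro (x : S.X₂.unop ⟶ E) (hx : S.g.unop ≫ x = 0)
  exact ⟨hS.unop.descToInjective x hx, hS.unop.comp_descToInjective x hx⟩

/-- The homology of `Hom(K, E)` is the `E`-dual of the homology of `K`, for `E` injective. -/
def dualHomologyIso (R : Type u) [CommRing R] (E : ModuleCat.{u} R)
    (hE : Injective E) (K : ChainComplex (ModuleCat.{u} R) ℤ) (i : ℤ) :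
    (K.linearYonedaObj R E).homology i ≅
      ((linearYoneda R (ModuleCat.{u} R)).obj E).obj (op (K.homology i)) :=
  haveI := linYonedaPreservesHomology R E hE
  (show (K.linearYonedaObj R E).homology i ≅
    ((K.sc i).op.map ((linearYoneda R (ModuleCat.{u} R)).obj E)).homology from Iso.refl _) ≪≫
  (K.sc i).op.mapHomologyIso _ ≪≫
  ((linearYoneda R (ModuleCat.{u} R)).obj E).mapIso (K.sc i).homologyOpIso

/-- Tensor-hom adjunction for a complex `K`. -/
def tensorHomComplexIso (R : Type u) [CommRing R] (N E : Type u) [AddCommGroup N] [Module R N]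
    [AddCommGroup E] [Module R E] (K : ChainComplex (ModuleCat.{u} R) ℤ) :
    K.linearYonedaObj R (ModuleCat.of R (N →ₗ[R] E)) ≅
      ChainComplex.linearYonedaObj ((((tensoringRight (ModuleCat.{u} R)).obj
        (ModuleCat.of R N)).mapHomologicalComplex _).obj K) R (ModuleCat.of R E) :=
  HomologicalComplex.Hom.isoOfComponents
    (fun j => LinearEquiv.toModuleIso
      ((ModuleCat.homLinearEquiv (S := R) (M := K.X j) (N := ModuleCat.of R (N →ₗ[R] E))) ≪≫ₗ
        (TensorProduct.lift.equiv (.id R) (K.X j) N E) ≪≫ₗ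
        (ModuleCat.homLinearEquiv (S := R) (M := ModuleCat.of R (TensorProduct R (K.X j) N))
          (N := ModuleCat.of R E)).symm))
    (by
      intro a b _
      apply ModuleCat.hom_ext
      apply LinearMap.ext
      intro f
      apply ModuleCat.hom_ext
      apply TensorProduct.ext'
      intro x y
      rfl)

/-- Let `(R,m,k)` be a (Noetherian) local ring and `M`, `N` finitely generated `R`-modules
with `G-dim_R M < ∞`. Then `Êxt^i_R(M, N^∨) ≅ (T̂or_i^R(M,N))^∨` for all `i ∈ ℤ`, where
`(-)^∨ = Hom_R(-, E_R(k))` is Matlis duality. -/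
theorem stmt_2 (R : Type) [CommRing R] [IsNoetherianRing R] [IsLocalRing R]
    (M N : Type) [AddCommGroup M] [Module R M] [Module.Finite R M]
    [AddCommGroup N] [Module R N] [Module.Finite R N]
    (hM : HasFiniteGDim R (ModuleCat.of R M))
    (E : Type) [AddCommGroup E] [Module R E]
    (hE : IsInjectiveEnvelopeOfResidueField R E)
    (C : CompleteResolution R (ModuleCat.of R M)) (i : ℤ) :
    Nonempty ((TateExt R C (ModuleCat.of R (N →ₗ[R] E)) i) ≃ₗ[R]
      ((TateTor R C (ModuleCat.of R N) i) →ₗ[R] E)) := by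
  have e := (HomologicalComplex.homologyMapIso (tensorHomComplexIso R N E C.T) i) ≪≫
    dualHomologyIso R (ModuleCat.of R E) hE.1 _ i
  exact ⟨e.toLinearEquiv ≪≫ₗ ModuleCat.homLinearEquiv (S := R)⟩

end
end

section
/- Let M and N be finitely generated R-modules with G-dim_R(M) < ∞, and let x ∈ R be both a non-zerodivisor on R and a non-zerodivisor on M, with xN = 0. Writing R̄ = R/xR and M̄ = M/xM, there are isomorphisms Êxt^i_R(M,N) ≅ Êxt^i_{R̄}(M̄,N) and T̂or_i^R(M,N) ≅ T̂or_i^{R̄}(M̄,N) for all i ∈ ℤ. -/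
open CategoryTheory CategoryTheory.Limits CategoryTheory.MonoidalCategory Opposite

noncomputable section

universe u

variable (R : Type u) [CommRing R]

theorem down_ext {F : ℤ → Type*} (Q : ∀ i, F i → F (i+1) → Prop) (m : ℤ) (f0 : ∀ i, F i)
    (h0 : ∀ i, m ≤ i → Q i (f0 i) (f0 (i+1)))
    (step : ∀ i, i < m → ∀ b c, Q (i+1) b c → ∃ a, Q i a b) :
    ∃ f : ∀ i, F i, (∀ i, m ≤ i → f i = f0 i) ∧ ∀ i, Q i (f i) (f (i+1)) := by
  let S : ℕ → Type _ := fun n => {f : ∀ i, F i // ∀ i, m - n ≤ i → Q i (f i) (f (i+1))}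
  have ex : ∀ n (f : S n), ∃ g : S (n+1), ∀ i, m - n ≤ i → g.1 i = f.1 i := by
    intro n f
    obtain ⟨j, hj⟩ : ∃ j, j = m - n - 1 := ⟨_, rfl⟩
    obtain ⟨a, ha⟩ := step j (by omega) _ _ (f.2 (j+1) (by omega))
    refine ⟨⟨Function.update f.1 j a, ?_⟩, ?_⟩
    · intro i hi
      by_cases h : i = j
      · subst h
        rw [Function.update_self, Function.update_of_ne (by omega)]
        exact ha
      · rw [Function.update_of_ne h, Function.update_of_ne (by push_cast at hi; omega)]
        exact f.2 i (by push_cast at hi; omega)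
    · intro i hi
      exact Function.update_of_ne (by omega) _ _
  choose nx hnx using ex
  let s : ∀ n, S n := fun n => Nat.rec (motive := S) ⟨f0, by simpa using h0⟩ nx n
  have hs : ∀ (n k : ℕ) (i : ℤ), m - n ≤ i → (s (n+k)).1 i = (s n).1 i := by
    intro n k i hi
    induction k with
    | zero => rfl
    | succ k ih => rw [← ih]; exact hnx (n+k) (s (n+k)) i (by push_cast; omega)
  refine ⟨fun i => (s (m-i).toNat).1 i, ?_, ?_⟩
  · intro i hi
    have := hs 0 (m - i).toNat i (by simpa using hi)
    rw [Nat.zero_add] at this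
    exact this
  · intro i
    have h1 := (s (m-i).toNat).2 i (by omega)
    obtain ⟨k, hk⟩ : ∃ k, (m-i).toNat = (m-(i+1)).toNat + k :=
      ⟨(m-i).toNat - (m-(i+1)).toNat, by omega⟩
    have h2 := hs (m-(i+1)).toNat k (i+1) (by omega)
    rw [← hk] at h2
    rw [h2] at h1
    exact h1

theorem up_ext {F : ℤ → Type*} (Q : ∀ i, F i → F (i+1) → Prop) (m : ℤ) (f0 : ∀ i, F i)
    (h0 : ∀ i, i < m → Q i (f0 i) (f0 (i+1)))
    (step : ∀ i, m ≤ i + 1 → ∀ a b, Q i a b → ∃ c, Q (i+1) b c) :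
    ∃ f : ∀ i, F i, (∀ i, i ≤ m → f i = f0 i) ∧ ∀ i, Q i (f i) (f (i+1)) := by
  let S : ℕ → Type _ := fun n => {f : ∀ i, F i // ∀ i, i < m + n → Q i (f i) (f (i+1))}
  have ex : ∀ n (f : S n), ∃ g : S (n+1), ∀ i, i ≤ m + n → g.1 i = f.1 i := by
    intro n f
    obtain ⟨j, hj⟩ : ∃ j, j = m + n - 1 := ⟨_, rfl⟩
    obtain ⟨a, ha⟩ := step j (by omega) _ _ (f.2 j (by omega))
    refine ⟨⟨Function.update f.1 (j+1+1) a, ?_⟩, ?_⟩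
    · intro i hi
      by_cases h : i = j+1
      · subst h
        rw [Function.update_self, Function.update_of_ne (by omega)]
        exact ha
      · rw [Function.update_of_ne (by push_cast at hi; omega), Function.update_of_ne (by omega)]
        exact f.2 i (by push_cast at hi; omega)
    · intro i hi
      exact Function.update_of_ne (by omega) _ _
  choose nx hnx using ex
  let s : ∀ n, S n := fun n => Nat.rec (motive := S) ⟨f0, by simpa using h0⟩ nx n
  have hs : ∀ (n k : ℕ) (i : ℤ), i ≤ m + n → (s (n+k)).1 i = (s n).1 i := by
    intro n k i hi
    induction k with
    | zero => rfl
    | succ k ih => rw [← ih]; exact hnx (n+k) (s (n+k)) i (by push_cast; omega)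
  refine ⟨fun i => (s (i-m).toNat).1 i, ?_, ?_⟩
  · intro i hi
    have := hs 0 (i - m).toNat i (by simpa using hi)
    rw [Nat.zero_add] at this
    exact this
  · intro i
    have h1 := (s (i+1-m).toNat).2 i (by omega)
    obtain ⟨k, hk⟩ : ∃ k, (i+1-m).toNat = (i-m).toNat + k :=
      ⟨(i+1-m).toNat - (i-m).toNat, by omega⟩
    have h2 := hs (i-m).toNat k i (by omega)
    rw [← hk] at h2
    rw [h2] at h1
    exact h1

section Htp

variable {V : Type*} [Category V] [Preadditive V]

theorem htp_of {T U : ChainComplex V ℤ} (g : T ⟶ U) (h : ∀ i, T.X i ⟶ U.X (i+1))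
    (hh : ∀ i, g.f (i+1) = T.d (i+1) i ≫ h i + h (i+1) ≫ U.d (i+1+1) (i+1)) :
    Nonempty (Homotopy g 0) := by
  let h' : ∀ i j, (ComplexShape.down ℤ).Rel j i → (T.X i ⟶ U.X j) :=
    fun i j r => h i ≫ eqToHom (by have : i + 1 = j := r; rw [this])
  have : g = Homotopy.nullHomotopicMap' h' := by
    ext k
    obtain ⟨i, rfl⟩ : ∃ i, k = i + 1 := ⟨k - 1, by omega⟩
    rw [Homotopy.nullHomotopicMap'_f (k₂ := i+1+1) (k₁ := i+1) (k₀ := i) rfl rfl, hh]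
    simp [h']
  rw [this]
  exact ⟨Homotopy.nullHomotopy' h'⟩

theorem of_htp {T U : ChainComplex V ℤ} (g : T ⟶ U) (H : Homotopy g 0) :
    ∀ i, g.f (i+1) = T.d (i+1) i ≫ H.hom i (i+1) + H.hom (i+1) (i+1+1) ≫ U.d (i+1+1) (i+1) := by
  intro i
  have := H.comm (i+1)
  rw [dNext_eq (w := show (ComplexShape.down ℤ).Rel (i+1) i from rfl),
    prevD_eq (w := show (ComplexShape.down ℤ).Rel (i+1+1) (i+1) from rfl)] at this
  simpa using this

/-- build a chain map -/
def mkMap {T U : ChainComplex V ℤ} (f : ∀ i, T.X i ⟶ U.X i)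
    (hf : ∀ i, T.d (i+1) i ≫ f i = f (i+1) ≫ U.d (i+1) i) : T ⟶ U where
  f := f
  comm' i j r := by
    have : j + 1 = i := r
    subst this
    exact (hf j).symm

/-- `Hom(T, U_j)` is exact -/
def HomEx (T U : ChainComplex V ℤ) : Prop :=
  ∀ i j (g : T.X (i+1) ⟶ U.X j), T.d (i+1+1) (i+1) ≫ g = 0 → ∃ g', g = T.d (i+1) i ≫ g'

theorem htp_down {T U : ChainComplex V ℤ} (hT : HomEx T U) (g : T ⟶ U) (m : ℤ)
    (hg : ∀ i, m ≤ i → g.f i = 0) : Nonempty (Homotopy g 0) := by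
  obtain ⟨h, -, hh⟩ := down_ext (F := fun i => T.X i ⟶ U.X (i+1))
    (fun i a b => g.f (i+1) = T.d (i+1) i ≫ a + b ≫ U.d (i+1+1) (i+1)) m (fun i => 0)
    (fun i hi => by simp [hg (i+1) (by omega)]) (by
      intro i hi b c hbc
      obtain ⟨a, ha⟩ := hT i (i+1) (g.f (i+1) - b ≫ U.d (i+1+1) (i+1)) (by
        rw [Preadditive.comp_sub, ← g.comm, hbc]; simp)
      exact ⟨a, by rw [← ha]; simp⟩)
  exact htp_of g h hh

theorem lift_down {T U P : ChainComplex V ℤ} (hU : HomEx T U) (hP : HomEx T P) (θ : U ⟶ P)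
    (hθ : ∃ n : ℤ, ∀ i, n ≤ i → IsIso (θ.f i)) (φ : T ⟶ P) :
    ∃ ψ : T ⟶ U, Nonempty (Homotopy (ψ ≫ θ) φ) := by
  classical
  obtain ⟨n, hn⟩ := hθ
  obtain ⟨f, hf0, hf⟩ := down_ext (F := fun i => T.X i ⟶ U.X i)
    (fun i a b => T.d (i+1) i ≫ a = b ≫ U.d (i+1) i) n
    (fun i => if h : n ≤ i then haveI := hn i h; φ.f i ≫ inv (θ.f i) else 0)
    (fun i hi => by
      have := hn i hi
      have := hn (i+1) (by omega)
      simp only [dif_pos hi, dif_pos (show n ≤ i+1 by omega)]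
      rw [← cancel_mono (θ.f i)]
      simp only [Category.assoc, IsIso.inv_hom_id, Category.comp_id, ← θ.comm,
        IsIso.inv_hom_id_assoc, φ.comm]) (by
      intro i hi b c hbc
      obtain ⟨a, ha⟩ := hU i i (b ≫ U.d (i+1) i) (by
        rw [← Category.assoc, hbc]; simp)
      exact ⟨a, ha.symm⟩)
  refine ⟨mkMap f hf, ?_⟩
  obtain ⟨H⟩ := htp_down hP (mkMap f hf ≫ θ - φ) n (by
    intro i hi
    have := hn i hi
    simp [mkMap, hf0 i hi, dif_pos hi])
  exact ⟨Homotopy.equivSubZero.symm H⟩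

theorem htp_cancel {T U P : ChainComplex V ℤ} (hU : HomEx T U) (θ : U ⟶ P)
    (hθ : ∃ n : ℤ, ∀ i, n ≤ i → IsIso (θ.f i)) (ψ : T ⟶ U)
    (H : Homotopy (ψ ≫ θ) 0) : Nonempty (Homotopy ψ 0) := by
  classical
  obtain ⟨n, hn⟩ := hθ
  let k : ∀ i j, (ComplexShape.down ℤ).Rel j i → (T.X i ⟶ U.X j) := fun i j _ =>
    if h : n ≤ j then haveI := hn j h; H.hom i j ≫ inv (θ.f j) else 0
  obtain ⟨K⟩ := htp_down hU (ψ - Homotopy.nullHomotopicMap' k) n (by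
    intro j hj
    obtain ⟨i, rfl⟩ : ∃ i, j = i + 1 := ⟨j - 1, by omega⟩
    have := hn (i+1) hj
    have := hn (i+1+1) (by omega)
    rw [HomologicalComplex.sub_f_apply,
      Homotopy.nullHomotopicMap'_f (k₂ := i+1+1) (k₁ := i+1) (k₀ := i) rfl rfl,
      ← cancel_mono (θ.f (i+1))]
    have := of_htp _ H i
    rw [HomologicalComplex.comp_f] at this
    simp [k, hj, show n ≤ i+1+1 by omega, this]
    rw [← θ.comm, IsIso.inv_hom_id_assoc, sub_self])
  exact ⟨(Homotopy.equivSubZero.symm K).trans (Homotopy.nullHomotopy' k)⟩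

theorem tate_equiv {T₁ T₂ P₁ P₂ : ChainComplex V ℤ} (h11 : HomEx T₁ T₁) (h12 : HomEx T₁ T₂)
    (h21 : HomEx T₂ T₁) (h22 : HomEx T₂ T₂) (k12 : HomEx T₁ P₂)
    (k21 : HomEx T₂ P₁)
    (θ₁ : T₁ ⟶ P₁) (θ₂ : T₂ ⟶ P₂)
    (hθ₁ : ∃ n : ℤ, ∀ i, n ≤ i → IsIso (θ₁.f i))
    (hθ₂ : ∃ n : ℤ, ∀ i, n ≤ i → IsIso (θ₂.f i))
    (e : HomotopyEquiv P₁ P₂) : Nonempty (HomotopyEquiv T₁ T₂) := by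
  obtain ⟨f, ⟨F⟩⟩ := lift_down h12 k12 θ₂ hθ₂ (θ₁ ≫ e.hom)
  obtain ⟨g, ⟨G⟩⟩ := lift_down h21 k21 θ₁ hθ₁ (θ₂ ≫ e.inv)
  -- f θ₂ ~ θ₁ e, g θ₁ ~ θ₂ e⁻¹
  have A : Homotopy ((f ≫ g) ≫ θ₁) θ₁ := by
    have a1 := (Homotopy.ofEq (Category.assoc f g θ₁)).trans (G.compLeft f)
    have a2 := (Homotopy.ofEq (Category.assoc f θ₂ e.inv).symm).trans (F.compRight e.inv)
    have a3 := (Homotopy.ofEq (Category.assoc θ₁ e.hom e.inv)).trans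
      (e.homotopyHomInvId.compLeft θ₁)
    exact ((a1.trans a2).trans a3).trans (Homotopy.ofEq (Category.comp_id _))
  have B : Homotopy ((g ≫ f) ≫ θ₂) θ₂ := by
    have a1 := (Homotopy.ofEq (Category.assoc g f θ₂)).trans (F.compLeft g)
    have a2 := (Homotopy.ofEq (Category.assoc g θ₁ e.hom).symm).trans (G.compRight e.hom)
    have a3 := (Homotopy.ofEq (Category.assoc θ₂ e.inv e.hom)).trans
      (e.homotopyInvHomId.compLeft θ₂)
    exact ((a1.trans a2).trans a3).trans (Homotopy.ofEq (Category.comp_id _))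
  obtain ⟨A'⟩ := htp_cancel h11 θ₁ hθ₁ (f ≫ g - 𝟙 _)
    ((Homotopy.ofEq (by simp)).trans (Homotopy.equivSubZero A))
  obtain ⟨B'⟩ := htp_cancel h22 θ₂ hθ₂ (g ≫ f - 𝟙 _)
    ((Homotopy.ofEq (by simp)).trans (Homotopy.equivSubZero B))
  exact ⟨⟨f, g, Homotopy.equivSubZero.symm A', Homotopy.equivSubZero.symm B'⟩⟩

end Htp

section Res

variable {V : Type*} [Category V] [Abelian V]

/-- A projective resolution indexed by `ℤ`. -/
structure IsRes (P : ChainComplex V ℤ) {M : V} (π : P.X 0 ⟶ M) : Prop where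
  proj : ∀ i, Projective (P.X i)
  zero : ∀ i : ℤ, i < 0 → IsZero (P.X i)
  epi : Epi π
  w : P.d 1 0 ≫ π = 0
  exact0 : (ShortComplex.mk (P.d 1 0) π w).Exact
  exact : ∀ i : ℤ, 0 < i → P.ExactAt i

theorem exactAt_lift {P : ChainComplex V ℤ} (i : ℤ) (h : P.ExactAt (i+1)) {A : V} [Projective A]
    (g : A ⟶ P.X (i+1)) (hg : g ≫ P.d (i+1) i = 0) : ∃ g', g' ≫ P.d (i+1+1) (i+1) = g := by
  rw [HomologicalComplex.exactAt_iff' _ (i+1+1) (i+1) i (by simp) (by simp)] at h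
  exact ⟨h.liftFromProjective g hg, h.liftFromProjective_comp _ _⟩

theorem res_lift {P P' : ChainComplex V ℤ} {M : V} {π : P.X 0 ⟶ M} {π' : P'.X 0 ⟶ M}
    (hP : IsRes P π) (hP' : IsRes P' π') : ∃ f : P ⟶ P', f.f 0 ≫ π' = π := by
  have := hP.proj
  have := hP'.epi
  let f0 := Projective.factorThru π π'
  have h0 : f0 ≫ π' = π := Projective.factorThru_comp _ _
  let f1 : P.X 1 ⟶ P'.X 1 := hP'.exact0.liftFromProjective (P.d 1 0 ≫ f0) (by simp [h0, hP.w])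
  have h1 : f1 ≫ P'.d 1 0 = P.d 1 0 ≫ f0 := hP'.exact0.liftFromProjective_comp _ _
  obtain ⟨f, hf0, hf⟩ := up_ext (F := fun i => P.X i ⟶ P'.X i)
    (fun i a b => P.d (i+1) i ≫ a = b ≫ P'.d (i+1) i) 1
    (Function.update (Function.update (fun i => 0) 0 f0) 1 f1)
    (fun i hi => by
      rcases lt_or_eq_of_le (show i ≤ 0 by omega) with h | rfl
      · exact (hP'.zero i h).eq_of_tgt _ _
      · exact h1.symm) (by
      intro i hi a b hab
      obtain ⟨c, hc⟩ := exactAt_lift i (hP'.exact _ (by omega)) (P.d (i+1+1) (i+1) ≫ b) (by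
        rw [Category.assoc, ← hab]; simp)
      exact ⟨c, hc.symm⟩)
  refine ⟨mkMap f hf, ?_⟩
  have : f 0 = f0 := by rw [hf0 0 (by omega)]; rfl
  simp [mkMap, this, h0]

theorem res_htp {P P' : ChainComplex V ℤ} {M M' : V} {π : P.X 0 ⟶ M} {π' : P'.X 0 ⟶ M'}
    (hP : IsRes P π) (hP' : IsRes P' π') (g : P ⟶ P') (hg : g.f 0 ≫ π' = 0) :
    Nonempty (Homotopy g 0) := by
  have := hP.proj
  let h0 : P.X 0 ⟶ P'.X 1 := hP'.exact0.liftFromProjective (g.f 0) hg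
  have hh0 : h0 ≫ P'.d 1 0 = g.f 0 := hP'.exact0.liftFromProjective_comp _ _
  obtain ⟨h, -, hh⟩ := up_ext (F := fun i => P.X i ⟶ P'.X (i+1))
    (fun i a b => g.f (i+1) = P.d (i+1) i ≫ a + b ≫ P'.d (i+1+1) (i+1)) 0
    (Function.update (fun i => 0) 0 h0)
    (fun i hi => by
      rcases lt_or_eq_of_le (show i ≤ -1 by omega) with h | rfl
      · exact (hP.zero (i+1) (by omega)).eq_of_src _ _
      · rw [(hP.zero (-1) (by omega)).eq_of_tgt (P.d (-1+1) (-1)) 0, zero_comp, zero_add]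
        exact hh0.symm) (by
      intro i hi a b hab
      obtain ⟨c, hc⟩ := exactAt_lift (i+1) (hP'.exact _ (by omega))
        (g.f (i+1+1) - P.d (i+1+1) (i+1) ≫ b) (by
        rw [Preadditive.sub_comp, g.comm, hab]; simp)
      exact ⟨c, by rw [hc]; simp⟩)
  exact htp_of g h hh

theorem res_equiv {P P' : ChainComplex V ℤ} {M : V} {π : P.X 0 ⟶ M} {π' : P'.X 0 ⟶ M}
    (hP : IsRes P π) (hP' : IsRes P' π') : Nonempty (HomotopyEquiv P P') := by
  obtain ⟨f, hf⟩ := res_lift hP hP'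
  obtain ⟨g, hg⟩ := res_lift hP' hP
  obtain ⟨A⟩ := res_htp hP hP (f ≫ g - 𝟙 _) (by simp [hf, hg])
  obtain ⟨B⟩ := res_htp hP' hP' (g ≫ f - 𝟙 _) (by simp [hf, hg])
  exact ⟨⟨f, g, Homotopy.equivSubZero.symm A, Homotopy.equivSubZero.symm B⟩⟩

end Res

section Mods

variable {S : Type u} [CommRing S]

/-- `Hom(T, S)` is exact -/
def DualEx (T : ChainComplex (ModuleCat.{u} S) ℤ) : Prop :=
  ∀ i (g : T.X (i+1) →ₗ[S] S), g ∘ₗ (T.d (i+1+1) (i+1)).hom = 0 →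
    ∃ g' : T.X i →ₗ[S] S, g = g' ∘ₗ (T.d (i+1) i).hom

theorem DualEx.homEx {T U : ChainComplex (ModuleCat.{u} S) ℤ} (hT : DualEx T)
    (hU : ∀ i, Projective (U.X i)) (hU' : ∀ i, Module.Finite S (U.X i)) : HomEx T U := by
  intro i j g hg
  have : Module.Projective S (U.X j) := (IsProjective.iff_projective _).2 (hU j)
  have := hU' j
  obtain ⟨n, p, s, -, -, hps⟩ := Module.Finite.exists_comp_eq_id_of_projective S (U.X j)
  have h1 : ∀ k : Fin n, ∃ g' : T.X i →ₗ[S] S,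
      LinearMap.proj k ∘ₗ s ∘ₗ g.hom = g' ∘ₗ (T.d (i+1) i).hom := by
    intro k
    refine hT i _ ?_
    have : g.hom ∘ₗ (T.d (i+1+1) (i+1)).hom = 0 := by
      rw [← ModuleCat.hom_comp, hg]; rfl
    rw [LinearMap.comp_assoc, LinearMap.comp_assoc, this]; simp
  choose g' hg' using h1
  refine ⟨ModuleCat.ofHom (p ∘ₗ LinearMap.pi g'), ?_⟩
  ext t
  have h2 : s (g.hom t) = LinearMap.pi g' ((T.d (i+1) i).hom t) := by
    ext k
    exact LinearMap.congr_fun (hg' k) t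
  have h3 : p (s (g.hom t)) = g.hom t := LinearMap.congr_fun hps _
  simp only [ModuleCat.hom_comp, ModuleCat.hom_ofHom, LinearMap.comp_apply]
  rw [← h2, h3]

theorem dualEx_of {T : ChainComplex (ModuleCat.{u} S) ℤ}
    (h : ∀ i : ℤ, (T.linearYonedaObj S (ModuleCat.of S S)).ExactAt i) : DualEx T := by
  intro i g hg
  have h := h (i+1)
  rw [HomologicalComplex.exactAt_iff' _ i (i+1) (i+1+1) (by simp) (by simp),
    ShortComplex.moduleCat_exact_iff] at h
  obtain ⟨g', h'⟩ := h (ModuleCat.ofHom g) (by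
    change T.d (i+1+1) (i+1) ≫ ModuleCat.ofHom g = 0
    ext t
    exact LinearMap.congr_fun hg t)
  change T.d (i+1) i ≫ g' = ModuleCat.ofHom g at h'
  exact ⟨(show T.X i ⟶ ModuleCat.of S S from g').hom, (congrArg ModuleCat.Hom.hom h').symm⟩

theorem exactAt_iff_elem (P : ChainComplex (ModuleCat.{u} S) ℤ) (i : ℤ) :
    P.ExactAt (i+1) ↔ ∀ t : P.X (i+1), (P.d (i+1) i).hom t = 0 →
      ∃ v : P.X (i+1+1), (P.d (i+1+1) (i+1)).hom v = t := by
  rw [HomologicalComplex.exactAt_iff' _ (i+1+1) (i+1) i (by simp) (by simp),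
    ShortComplex.moduleCat_exact_iff]
  rfl

theorem tateExt_iso {T T' : ChainComplex (ModuleCat.{u} S) ℤ} (e : HomotopyEquiv T T')
    (N : ModuleCat.{u} S) (i : ℤ) :
    Nonempty ((T.linearYonedaObj S N).homology i ≅ (T'.linearYonedaObj S N).homology i) := by
  let F := ((linearYoneda S (ModuleCat.{u} S)).obj N).rightOp
  exact ⟨HomologicalComplex.homologyUnop _ _ ≪≫
    ((F.mapHomotopyEquiv e).toHomologyIso i).unop.symm ≪≫
    (HomologicalComplex.homologyUnop _ _).symm⟩

theorem tateTor_iso {T T' : ChainComplex (ModuleCat.{u} S) ℤ} (e : HomotopyEquiv T T')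
    (N : ModuleCat.{u} S) (i : ℤ) :
    Nonempty (((((tensoringRight (ModuleCat.{u} S)).obj N).mapHomologicalComplex _).obj T).homology i
      ≅ ((((tensoringRight (ModuleCat.{u} S)).obj N).mapHomologicalComplex _).obj T').homology i) :=
  ⟨(((tensoringRight (ModuleCat.{u} S)).obj N).mapHomotopyEquiv e).toHomologyIso i⟩

end Mods

section BC

open TensorProduct

variable (R : Type u) [CommRing R] (S : Type u) [CommRing S] [Algebra R S]

/-- base change -/
def bc : ModuleCat.{u} R ⥤ ModuleCat.{u} S where
  obj M := ModuleCat.of S (S ⊗[R] M)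
  map f := ModuleCat.ofHom (f.hom.baseChange S)
  map_id M := by ext; simp
  map_comp f g := by ext; simp [LinearMap.baseChange_comp]

instance : (bc R S).Additive where
  map_add {M N f g} := by
    ext1
    exact LinearMap.baseChange_add _ _

theorem bc_proj {M : ModuleCat.{u} R} (h : Projective M) : Projective ((bc R S).obj M) := by
  have : Module.Projective R M := (IsProjective.iff_projective _).2 h
  exact (IsProjective.iff_projective (S ⊗[R] M)).1 inferInstance

theorem bc_fin {M : ModuleCat.{u} R} (h : Module.Finite R M) :
    Module.Finite S ((bc R S).obj M) := by
  exact inferInstanceAs (Module.Finite S (S ⊗[R] M))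

/-- restriction of scalars -/
abbrev rs : ModuleCat.{u} S ⥤ ModuleCat.{u} R := ModuleCat.restrictScalars (algebraMap R S)

theorem rs_homology {ι : Type} {c : ComplexShape ι} (K : HomologicalComplex (ModuleCat.{u} R) c)
    (L : HomologicalComplex (ModuleCat.{u} S) c)
    (e : K ≅ ((rs R S).mapHomologicalComplex c).obj L) (i : ι) :
    Nonempty (K.homology i ≃ₗ[R] RestrictScalars R S (L.homology i)) := by
  have a : K.homology i ≅ (rs R S).obj (L.homology i) :=
    HomologicalComplex.homologyMapIso e i ≪≫ (L.sc i).mapHomologyIso (rs R S)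
  exact ⟨a.toLinearEquiv⟩

variable (N : Type u) [AddCommGroup N] [Module R N] [Module S N] [IsScalarTower R S N]

/-- the linear map underlying a morphism -/
def bcLin {T : ModuleCat.{u} R} (g : (bc R S).obj T ⟶ ModuleCat.of S N) : S ⊗[R] T →ₗ[S] N := g.hom

/-- hom-tensor adjunction -/
def extEquiv (T : ModuleCat.{u} R) :
    (T ⟶ ModuleCat.of R N) ≃ₗ[R]
      (rs R S).obj (ModuleCat.of S ((bc R S).obj T ⟶ ModuleCat.of S N)) where
  toFun f := (ModuleCat.ofHom (LinearMap.liftBaseChange S f.hom) :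
    (bc R S).obj T ⟶ ModuleCat.of S N)
  invFun g := ModuleCat.ofHom
    ((bcLin R S N g).restrictScalars R ∘ₗ TensorProduct.mk R S T 1)
  map_add' f g := by
    apply ModuleCat.hom_ext
    exact map_add (LinearMap.liftBaseChangeEquiv S) f.hom g.hom
  map_smul' r f := by
    apply ModuleCat.hom_ext
    refine TensorProduct.AlgebraTensorModule.ext fun s t => ?_
    change s • (r • f.hom t) = algebraMap R S r • (s • f.hom t)
    rw [algebraMap_smul, smul_comm]
  left_inv f := by
    ext t
    change (1 : S) • f.hom t = f.hom t
    simp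
  right_inv g := by
    apply ModuleCat.hom_ext
    refine TensorProduct.AlgebraTensorModule.ext fun s t => ?_
    change s • bcLin R S N g (1 ⊗ₜ t) = bcLin R S N g (s ⊗ₜ t)
    rw [← map_smul, TensorProduct.smul_tmul', smul_eq_mul, mul_one]

/-- cancellation -/
def torEquiv (T : ModuleCat.{u} R) :
    (T ⊗ ModuleCat.of R N : ModuleCat R) ≃ₗ[R]
      (rs R S).obj ((bc R S).obj T ⊗ ModuleCat.of S N) :=
  let e : (T ⊗[R] N) ≃ₗ[R] ((S ⊗[R] T) ⊗[S] N) := (TensorProduct.comm R T N).trans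
    (((TensorProduct.AlgebraTensorModule.cancelBaseChange R S S N T).symm.trans
      (TensorProduct.comm S N (S ⊗[R] T))).restrictScalars R)
  { toFun := e
    invFun := e.symm
    map_add' := e.map_add
    map_smul' := fun r z => (e.map_smul r z).trans (algebraMap_smul S r (e z)).symm
    left_inv := e.left_inv
    right_inv := e.right_inv }

theorem tor_bc (T : ChainComplex (ModuleCat.{u} R) ℤ) (i : ℤ) :
    Nonempty (((((tensoringRight (ModuleCat.{u} R)).obj
        (ModuleCat.of R N)).mapHomologicalComplex _).obj T).homology i ≃ₗ[R]
      RestrictScalars R S (((((tensoringRight (ModuleCat.{u} S)).obj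
        (ModuleCat.of S N)).mapHomologicalComplex _).obj
          (((bc R S).mapHomologicalComplex _).obj T)).homology i)) := by
  apply rs_homology
  refine HomologicalComplex.Hom.isoOfComponents
    (fun j => (torEquiv R S N (T.X j)).toModuleIso) ?_
  intro j k _
  apply ModuleCat.hom_ext
  refine TensorProduct.ext' fun t n => ?_
  rfl

theorem ext_bc (T : ChainComplex (ModuleCat.{u} R) ℤ) (i : ℤ) :
    Nonempty ((T.linearYonedaObj R (ModuleCat.of R N)).homology i ≃ₗ[R]
      RestrictScalars R S ((ChainComplex.linearYonedaObj (((bc R S).mapHomologicalComplex _).obj T) S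
        (ModuleCat.of S N)).homology i)) := by
  apply rs_homology
  refine HomologicalComplex.Hom.isoOfComponents
    (fun j => (extEquiv R S N (T.X j)).toModuleIso) ?_
  intro j k _
  ext f
  apply ModuleCat.hom_ext
  refine TensorProduct.AlgebraTensorModule.ext fun s t => ?_
  rfl

end BC
section Main

open TensorProduct

variable (R : Type u) [CommRing R] (x : R)

theorem mk_surj (M : Type u) [AddCommGroup M] [Module R M] (z : (R ⧸ Ideal.span {x}) ⊗[R] M) :
    ∃ t : M, z = (1 : (R ⧸ Ideal.span {x})) ⊗ₜ t := by
  let e := TensorProduct.quotTensorEquivQuotSMul M (Ideal.span {x})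
  obtain ⟨t, ht⟩ := Submodule.mkQ_surjective _ (e z)
  refine ⟨t, e.injective ?_⟩
  rw [← ht]
  exact (TensorProduct.quotTensorEquivQuotSMul_mk_one_tmul _ _).symm

theorem mk_zero (M : Type u) [AddCommGroup M] [Module R M] (t : M)
    (h : (1 : (R ⧸ Ideal.span {x})) ⊗ₜ[R] t = 0) : ∃ s : M, t = x • s := by
  have h1 := TensorProduct.quotTensorEquivQuotSMul_mk_one_tmul (Ideal.span {x}) t
  have h2 : (Submodule.Quotient.mk t : M ⧸ (Ideal.span {x} • (⊤ : Submodule R M))) = 0 := by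
    refine h1.symm.trans ?_
    rw [← map_zero (TensorProduct.quotTensorEquivQuotSMul M (Ideal.span {x})), ← h]
  rw [Submodule.Quotient.mk_eq_zero, Submodule.ideal_span_singleton_smul,
    Submodule.mem_smul_pointwise_iff_exists] at h2
  obtain ⟨s, -, hs⟩ := h2
  exact ⟨s, hs.symm⟩

theorem x_tmul (M : Type u) [AddCommGroup M] [Module R M] (s : M) :
    (1 : (R ⧸ Ideal.span {x})) ⊗ₜ[R] (x • s) = 0 := by
  rw [TensorProduct.tmul_smul, TensorProduct.smul_tmul', Algebra.smul_def, mul_one]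
  rw [show algebraMap R (R ⧸ Ideal.span {x}) x = 0 from
    Ideal.Quotient.eq_zero_iff_mem.2 (Ideal.mem_span_singleton_self x), zero_tmul]

theorem reg_proj (hx : x ∈ nonZeroDivisors R) (M : ModuleCat.{u} R) (h : Projective M) :
    IsSMulRegular M x := by
  have : Module.Projective R M := (IsProjective.iff_projective _).2 h
  exact Module.Flat.isSMulRegular_of_nonZeroDivisors hx

variable {R x}

theorem bc_isRes (hx : x ∈ nonZeroDivisors R) {P : ChainComplex (ModuleCat.{u} R) ℤ}
    {M : ModuleCat.{u} R} (hM : IsSMulRegular M x) {π : P.X 0 ⟶ M} (h : IsRes P π) :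
    IsRes (((bc R (R ⧸ Ideal.span {x})).mapHomologicalComplex _).obj P) (M := (bc R (R ⧸ Ideal.span {x})).obj M) ((bc R (R ⧸ Ideal.span {x})).map π) where
  proj i := bc_proj _ _ (h.proj i)
  zero i hi := (bc R (R ⧸ Ideal.span {x})).map_isZero (h.zero i hi)
  epi := by
    have := h.epi
    rw [ModuleCat.epi_iff_surjective] at this
    exact (ModuleCat.epi_iff_surjective ((bc R (R ⧸ Ideal.span {x})).map π)).2
      (LinearMap.baseChange_surjective _ this)
  w := by
    change (bc R (R ⧸ Ideal.span {x})).map _ ≫ (bc R (R ⧸ Ideal.span {x})).map π = 0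
    rw [← Functor.map_comp, h.w, Functor.map_zero]
  exact0 := by
    have h0 := h.exact0
    have hs := h.epi
    rw [ModuleCat.epi_iff_surjective] at hs
    rw [ShortComplex.moduleCat_exact_iff] at h0 ⊢
    intro z hz
    obtain ⟨t, rfl⟩ := mk_surj R x (P.X 0) z
    obtain ⟨s, hs'⟩ := mk_zero R x M (π.hom t) hz
    obtain ⟨v, rfl⟩ := hs s
    obtain ⟨u, hu⟩ := h0 (t - x • v) (by
      change π.hom (t - x • v) = 0
      rw [map_sub, map_smul, hs']; exact sub_self _)
    change (P.d 1 0).hom u = t - x • v at hu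
    refine ⟨(1 : (R ⧸ Ideal.span {x})) ⊗ₜ[R] u, ?_⟩
    change (1 : (R ⧸ Ideal.span {x})) ⊗ₜ[R] ((P.d 1 0).hom u) = _
    rw [hu, tmul_sub, x_tmul, sub_zero]
  exact i hi := by
    obtain ⟨i, rfl⟩ : ∃ j, i = j + 1 := ⟨i - 1, by omega⟩
    have hex := (exactAt_iff_elem _ _).1 (h.exact _ hi)
    rw [exactAt_iff_elem]
    intro z hz
    obtain ⟨t, rfl⟩ := mk_surj R x (P.X (i+1)) z
    obtain ⟨s, hs⟩ := mk_zero R x (P.X i) ((P.d (i+1) i).hom t) hz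
    -- s is a boundary
    have hb : ∃ u, (P.d (i+1) i).hom u = s := by
      rcases lt_or_eq_of_le (show 0 ≤ i by omega) with h1 | rfl
      · obtain ⟨k, rfl⟩ : ∃ k, i = k + 1 := ⟨i - 1, by omega⟩
        refine (exactAt_iff_elem _ _).1 (h.exact _ h1) s ?_
        apply reg_proj R x hx _ (h.proj k)
        change x • _ = x • _
        rw [← map_smul, ← hs, smul_zero, ← LinearMap.comp_apply, ← ModuleCat.hom_comp]
        simp
      · have h0 := h.exact0
        rw [ShortComplex.moduleCat_exact_iff] at h0
        refine h0 s ?_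
        change π.hom s = 0
        apply hM
        change x • _ = x • _
        rw [← map_smul, ← hs, smul_zero]
        have : π.hom ((P.d 1 0).hom t) = (P.d 1 0 ≫ π).hom t := rfl
        refine this.trans ?_
        rw [h.w]; rfl
    obtain ⟨u, rfl⟩ := hb
    obtain ⟨v, hv⟩ := hex (t - x • u) (by rw [map_sub, map_smul, hs, sub_self])
    refine ⟨(1 : (R ⧸ Ideal.span {x})) ⊗ₜ[R] v, ?_⟩
    change (1 : (R ⧸ Ideal.span {x})) ⊗ₜ[R] ((P.d (i+1+1) (i+1)).hom v) = _
    rw [hv, tmul_sub, x_tmul, sub_zero]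

theorem lin_div (hx : x ∈ nonZeroDivisors R) {A : Type u} [AddCommGroup A] [Module R A]
    (f : A →ₗ[R] R) (hf : ∀ a, (Ideal.Quotient.mk (Ideal.span {x})) (f a) = 0) :
    ∃ b : A →ₗ[R] R, f = x • b := by
  have : ∀ a, ∃ r, f a = x * r := fun a =>
    Ideal.mem_span_singleton.1 (Ideal.Quotient.eq_zero_iff_mem.1 (hf a))
  choose b hb using this
  have hc : ∀ r s : R, x * r = x * s → r = s := fun r s h =>
    (mul_cancel_left_mem_nonZeroDivisors hx).1 h
  refine ⟨⟨⟨b, fun a a' => hc _ _ ?_⟩, fun r a => hc _ _ ?_⟩, ?_⟩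
  · rw [← hb, map_add, hb, hb, mul_add]
  · rw [← hb, map_smul, hb]; simp only [RingHom.id_apply, smul_eq_mul]; ring
  · ext a; exact hb a

theorem bc_dualEx (hx : x ∈ nonZeroDivisors R) {T : ChainComplex (ModuleCat.{u} R) ℤ}
    (hT : DualEx T) (hp : ∀ i, Projective (T.X i)) :
    DualEx (((bc R (R ⧸ Ideal.span {x})).mapHomologicalComplex _).obj T) := by
  intro i g hg
  have : Module.Projective R (T.X (i+1)) := (IsProjective.iff_projective _).2 (hp _)
  let g0 : (R ⧸ Ideal.span {x}) ⊗[R] (T.X (i+1)) →ₗ[(R ⧸ Ideal.span {x})] (R ⧸ Ideal.span {x}) := g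
  let g1 : T.X (i+1) →ₗ[R] (R ⧸ Ideal.span {x}) := (g0.restrictScalars R) ∘ₗ TensorProduct.mk R (R ⧸ Ideal.span {x}) (T.X (i+1)) 1
  obtain ⟨a, ha⟩ := Module.projective_lifting_property
    (Ideal.Quotient.mkₐ R (Ideal.span {x})).toLinearMap g1
    (Ideal.Quotient.mk_surjective)
  have ha' : ∀ t, Ideal.Quotient.mk (Ideal.span {x}) (a t) = g0 (1 ⊗ₜ t) :=
    fun t => LinearMap.congr_fun ha t
  have dd : ∀ j t, (T.d (j+1) j).hom ((T.d (j+1+1) (j+1)).hom t) = 0 := by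
    intro j t
    rw [← LinearMap.comp_apply, ← ModuleCat.hom_comp]
    simp
  obtain ⟨b, hb⟩ := lin_div hx (a ∘ₗ (T.d (i+1+1) (i+1)).hom) (fun t => by
    rw [LinearMap.comp_apply, ha']
    exact LinearMap.congr_fun hg ((1 : (R ⧸ Ideal.span {x})) ⊗ₜ t))
  obtain ⟨c, hc⟩ := hT (i+1) b (by
    ext t
    have h1 := LinearMap.congr_fun hb ((T.d (i+1+1+1) (i+1+1)).hom t)
    simp only [LinearMap.comp_apply, dd, map_zero, LinearMap.smul_apply, smul_eq_mul] at h1 ⊢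
    exact (mul_left_mem_nonZeroDivisors_eq_zero_iff hx).1 h1.symm)
  obtain ⟨e, he⟩ := hT i (a - x • c) (by
    rw [LinearMap.sub_comp, hb, hc, LinearMap.smul_comp, sub_self])
  refine ⟨LinearMap.liftBaseChange (R ⧸ Ideal.span {x}) ((Ideal.Quotient.mkₐ R (Ideal.span {x})).toLinearMap ∘ₗ e), ?_⟩
  refine TensorProduct.AlgebraTensorModule.ext fun s t => ?_
  change g0 (s ⊗ₜ t) = s • Ideal.Quotient.mk (Ideal.span {x}) (e ((T.d (i+1) i).hom t))
  have h2 := LinearMap.congr_fun he t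
  simp only [LinearMap.comp_apply, LinearMap.sub_apply, LinearMap.smul_apply, smul_eq_mul] at h2
  rw [← h2, map_sub, map_mul, show Ideal.Quotient.mk (Ideal.span {x}) x = 0 from
    Ideal.Quotient.eq_zero_iff_mem.2 (Ideal.mem_span_singleton_self x), zero_mul, sub_zero, ha',
    ← map_smul, TensorProduct.smul_tmul', smul_eq_mul, mul_one]

theorem CompleteResolution.isRes {S : Type u} [CommRing S] {M : ModuleCat.{u} S}
    (C : CompleteResolution S M) : IsRes C.P C.π :=
  ⟨C.projP, C.zeroP, C.epiπ, C.wπ, C.exact0, C.exactP⟩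

theorem main_equiv (hx : x ∈ nonZeroDivisors R) (M : Type u) [AddCommGroup M] [Module R M]
    (hM : IsSMulRegular M x) (C : CompleteResolution R (ModuleCat.of R M))
    (C' : CompleteResolution (R ⧸ Ideal.span {x}) (ModuleCat.of (R ⧸ Ideal.span {x}) ((R ⧸ Ideal.span {x}) ⊗[R] M))) :
    Nonempty (HomotopyEquiv (((bc R (R ⧸ Ideal.span {x})).mapHomologicalComplex _).obj C.T) C'.T) := by
  obtain ⟨e⟩ := res_equiv (bc_isRes hx hM C.isRes) C'.isRes
  have d := bc_dualEx hx (dualEx_of C.exactTdual) C.projT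
  have d' := dualEx_of C'.exactTdual
  refine tate_equiv (d.homEx ?_ ?_) (d.homEx C'.projT C'.fgT) (d'.homEx ?_ ?_)
    (d'.homEx C'.projT C'.fgT) (d.homEx C'.projP C'.fgP) (d'.homEx ?_ ?_)
    (((bc R (R ⧸ Ideal.span {x})).mapHomologicalComplex _).map C.θ) C'.θ ?_ C'.iso_eventually e
  · exact fun i => bc_proj _ _ (C.projT i)
  · exact fun i => bc_fin _ _ (C.fgT i)
  · exact fun i => bc_proj _ _ (C.projT i)
  · exact fun i => bc_fin _ _ (C.fgT i)
  · exact fun i => bc_proj _ _ (C.projP i)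
  · exact fun i => bc_fin _ _ (C.fgP i)
  · obtain ⟨n, hn⟩ := C.iso_eventually
    refine ⟨n, fun i hi => ?_⟩
    have := hn i hi
    change IsIso ((bc R (R ⧸ Ideal.span {x})).map (C.θ.f i))
    infer_instance

end Main

/-- Let `M`, `N` be finitely generated modules over a (Noetherian) local ring `R` with
`G-dim_R M < ∞`, and let `x ∈ R` be a non-zerodivisor on `R` and on `M` with `x N = 0`.
Writing `R̄ = R/xR` and `M̄ = M/xM (= R̄ ⊗_R M)`, there are isomorphisms
`Êxt^i_R(M,N) ≅ Êxt^i_{R̄}(M̄,N)` and `T̂or_i^R(M,N) ≅ T̂or_i^{R̄}(M̄,N)` for all `i ∈ ℤ`. -/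
theorem stmt_3 (R : Type) [CommRing R] [IsNoetherianRing R] [IsLocalRing R]
    (M : Type) [AddCommGroup M] [Module R M] [Module.Finite R M]
    (x : R) (hxR : x ∈ nonZeroDivisors R) (hxM : IsSMulRegular M x)
    (N : Type) [AddCommGroup N] [Module R N] [Module.Finite R N]
    [Module (R ⧸ Ideal.span {x}) N] [IsScalarTower R (R ⧸ Ideal.span {x}) N]
    (hM : HasFiniteGDim R (ModuleCat.of R M))
    (C : CompleteResolution R (ModuleCat.of R M))
    (C' : CompleteResolution (R ⧸ Ideal.span {x})
      (ModuleCat.of (R ⧸ Ideal.span {x}) (TensorProduct R (R ⧸ Ideal.span {x}) M)))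
    (i : ℤ) :
    Nonempty ((TateExt R C (ModuleCat.of R N) i) ≃ₗ[R]
      (RestrictScalars R (R ⧸ Ideal.span {x})
        (TateExt (R ⧸ Ideal.span {x}) C' (ModuleCat.of (R ⧸ Ideal.span {x}) N) i))) ∧
    Nonempty ((TateTor R C (ModuleCat.of R N) i) ≃ₗ[R]
      (RestrictScalars R (R ⧸ Ideal.span {x})
        (TateTor (R ⧸ Ideal.span {x}) C' (ModuleCat.of (R ⧸ Ideal.span {x}) N) i))) := by
  obtain ⟨e⟩ := main_equiv hxR M hxM C C'
  constructor
  · obtain ⟨a⟩ := ext_bc R (R ⧸ Ideal.span {x}) N C.T i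
    obtain ⟨b⟩ := tateExt_iso e (ModuleCat.of (R ⧸ Ideal.span {x}) N) i
    exact ⟨a.trans ((rs R (R ⧸ Ideal.span {x})).mapIso b).toLinearEquiv⟩
  · obtain ⟨a⟩ := tor_bc R (R ⧸ Ideal.span {x}) N C.T i
    obtain ⟨b⟩ := tateTor_iso e (ModuleCat.of (R ⧸ Ideal.span {x}) N) i
    exact ⟨a.trans ((rs R (R ⧸ Ideal.span {x})).mapIso b).toLinearEquiv⟩

end
end
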